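/- arXiv:2103.07924 — 4 statements merged into one kernel-verified Lean document; each statement's English description precedes it below -/
import Mathlib

section
/- If G is a connected unicyclic graph on n ≥ 5 vertices, then SO(G) ≤ (n−3)·√((n−1)² + 1) + 2·√((n−1)² + 4) + 2√2, with equality if and only if G is obtained from the star K_{1,n−1} by adding one edge between two pendant vertices. -/
attribute [local instance] Classical.propDecidable

/-- The Sombor index of a finite simple graph:
`SO(G) = Σ_{uv ∈ E(G)} √(d(u)² + d(v)²)`, written as half the sum over ordered adjacent pairs. -/
noncomputable def somborIndex {V : Type*} [Fintype V] (G : SimpleGraph V) : ℝ :=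
  (∑ u : V, ∑ v : V,
      if G.Adj u v then Real.sqrt ((G.degree u : ℝ)^2 + (G.degree v : ℝ)^2) else 0) / 2

/-- A cactus: a connected graph in which any two distinct cycles share at most one vertex. -/
def IsCactus {V : Type*} (G : SimpleGraph V) : Prop :=
  G.Connected ∧ ∀ (u v : V) (c₁ : G.Walk u u) (c₂ : G.Walk v v),
    c₁.IsCycle → c₂.IsCycle → c₁.edges.toFinset ≠ c₂.edges.toFinset →
      (c₁.support.toFinset ∩ c₂.support.toFinset).card ≤ 1

/-- `Hgraph n t` : the cactus obtained from the star `K_{1,n-1}` (center `0`) by joining the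
`t` disjoint pairs of pendant vertices `(2k+1, 2k+2)`, `k < t`, by edges. -/
def Hgraph (n t : ℕ) : SimpleGraph (Fin n) :=
  SimpleGraph.fromRel (fun u v =>
    u.val = 0 ∨ ∃ k, k < t ∧ u.val = 2 * k + 1 ∧ v.val = 2 * k + 2)

/-- `HstarGraph β t` : the cactus on `2β` vertices with a perfect matching: a center `0` of
degree `β + t` adjacent to `1, …, β + t`; `t` triangles through the center formed by the edges
`(2k+1, 2k+2)`, `k < t`; vertex `β + t` is a pendant vertex at the center; and each vertex
`2t + j` (`1 ≤ j ≤ β - t - 1`) carries the pendant vertex `β + t + j`. -/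
def HstarGraph (β t : ℕ) : SimpleGraph (Fin (2 * β)) :=
  SimpleGraph.fromRel (fun u v =>
    (u.val = 0 ∧ 1 ≤ v.val ∧ v.val ≤ β + t) ∨
    (∃ k, k < t ∧ u.val = 2 * k + 1 ∧ v.val = 2 * k + 2) ∨
    (∃ j, 1 ≤ j ∧ j ≤ β - t - 1 ∧ u.val = 2 * t + j ∧ v.val = β + t + j))

open Finset in
lemma SimpleGraph.degree_add_degree_le_card_edgeFinset_add_one {V : Type*} [Fintype V]
    (G : SimpleGraph V) {a b : V} (hab : a ≠ b) :
    G.degree a + G.degree b ≤ G.edgeFinset.card + 1 := by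
  have h1 : (G.incidenceFinset a ∩ G.incidenceFinset b).card ≤ 1 := by
    refine (card_le_card (t := {s(a, b)}) fun e he => ?_).trans (by simp)
    have := G.incidenceSet_inter_incidenceSet_subset hab
      (by simpa [SimpleGraph.mem_incidenceFinset] using he)
    simpa using this
  have h2 := card_le_card
    (union_subset (G.incidenceFinset_subset a) (G.incidenceFinset_subset b))
  have h3 := card_union_add_card_inter (G.incidenceFinset a) (G.incidenceFinset b)
  simp only [SimpleGraph.card_incidenceFinset_eq_degree] at h3
  omega

lemma SimpleGraph.sum_sum_ite_adj_add {V : Type*} [Fintype V] (G : SimpleGraph V) (g : V → ℝ) :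
    (∑ u : V, ∑ v : V, if G.Adj u v then g u + g v else 0) = 2 * ∑ u : V, G.degree u * g u := by
  have h1 : (∑ u : V, ∑ v : V, if G.Adj u v then g u else 0) = ∑ u : V, G.degree u * g u := by
    refine Finset.sum_congr rfl fun u _ => ?_
    rw [← Finset.sum_filter, Finset.sum_const, nsmul_eq_mul, ← G.card_neighborFinset_eq_degree,
      G.neighborFinset_eq_filter]
  have h2 : (∑ u : V, ∑ v : V, if G.Adj u v then g v else 0) = ∑ u : V, G.degree u * g u := by
    rw [Finset.sum_comm, ← h1]
    simp only [G.adj_comm]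
  rw [two_mul]
  nth_rewrite 1 [← h1]
  rw [← h2]
  simp only [← Finset.sum_add_distrib]
  refine Finset.sum_congr rfl fun u _ => Finset.sum_congr rfl fun v _ => ?_
  split_ifs <;> simp

lemma sqrt_two_sq_add_two_sq : √((2 : ℝ) ^ 2 + 2 ^ 2) = 2 * √2 := by
  rw [show (2 : ℝ) ^ 2 + 2 ^ 2 = 2 ^ 2 * 2 by norm_num, Real.sqrt_mul (by norm_num),
    Real.sqrt_sq (by norm_num)]

/-- Convexity of `x ↦ √(x² + q²)` between `2` and `N`. -/
lemma mul_sqrt_sq_add_le {N c q : ℝ} (hc : 2 ≤ c) (hcN : c ≤ N) :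
    (N - 2) * √(c ^ 2 + q ^ 2) ≤ (N - c) * √(2 ^ 2 + q ^ 2) + (c - 2) * √(N ^ 2 + q ^ 2) := by
  have hx := Real.sq_sqrt (by positivity : 0 ≤ 2 ^ 2 + q ^ 2)
  have hy := Real.sq_sqrt (by positivity : 0 ≤ N ^ 2 + q ^ 2)
  have hz := Real.sq_sqrt (by positivity : 0 ≤ c ^ 2 + q ^ 2)
  have hx0 := Real.sqrt_nonneg (2 ^ 2 + q ^ 2)
  have hy0 := Real.sqrt_nonneg (N ^ 2 + q ^ 2)
  have hxy : 2 * N + q ^ 2 ≤ √(2 ^ 2 + q ^ 2) * √(N ^ 2 + q ^ 2) := by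
    rw [← Real.sqrt_mul (by positivity)]
    apply Real.le_sqrt_of_sq_le
    nlinarith [mul_nonneg (sq_nonneg q) (sq_nonneg (N - 2))]
  set x := √(2 ^ 2 + q ^ 2)
  set y := √(N ^ 2 + q ^ 2)
  set z := √(c ^ 2 + q ^ 2)
  have h1 : 0 ≤ N - c := by linarith
  have h2 : 0 ≤ c - 2 := by linarith
  refine (sq_le_sq₀ (mul_nonneg (by linarith) (Real.sqrt_nonneg _)) (by positivity)).1 ?_
  have e1 : ((N - 2) * z) ^ 2 = (N - 2) ^ 2 * (c ^ 2 + q ^ 2) := by rw [mul_pow, hz]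
  have e2 : ((N - c) * x + (c - 2) * y) ^ 2 = (N - c) ^ 2 * (2 ^ 2 + q ^ 2)
      + (c - 2) ^ 2 * (N ^ 2 + q ^ 2) + 2 * ((N - c) * (c - 2)) * (x * y) := by
    rw [← hx, ← hy]; ring
  rw [e1, e2]
  nlinarith [mul_le_mul_of_nonneg_left hxy (mul_nonneg h1 h2)]

section Weight

variable {N A B m : ℝ}

lemma sqrt_diff_lt (hN : 4 ≤ N) (hA : A = √(N ^ 2 + 1)) (hB : B = √(N ^ 2 + 4)) :
    B - A < 0.58 ∧ A ≤ B ∧ 4 ≤ A := by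
  have hA2 : A ^ 2 = N ^ 2 + 1 := by rw [hA, Real.sq_sqrt (by positivity)]
  have hB2 : B ^ 2 = N ^ 2 + 4 := by rw [hB, Real.sq_sqrt (by positivity)]
  have hA4 : 4 ≤ A := by rw [hA]; apply Real.le_sqrt_of_sq_le; nlinarith
  refine ⟨?_, ?_, hA4⟩
  · by_contra! h
    nlinarith
  · rw [hA, hB]; gcongr; norm_num

/-- The chord slope `m` of `x ↦ √(x² + 4)` on `[2, N]` gives an edge bound that is a sum of two
vertex weights. -/
lemma sqrt_sq_add_sq_le_weight (hN : 4 ≤ N) (hA : A = √(N ^ 2 + 1)) (hB : B = √(N ^ 2 + 4))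
    (hm : m * (N - 2) = B - 2 * √2) {a b : ℕ} (ha : 1 ≤ a) (hb : 1 ≤ b) (haN : (a : ℝ) ≤ N)
    (hbN : (b : ℝ) ≤ N) (hab : (a : ℝ) + b ≤ N + 2) :
    √((a : ℝ) ^ 2 + (b : ℝ) ^ 2) ≤
      (√2 - 2 * m + m * a + (A - B + m) * (if a = 1 then 1 else 0)) +
      (√2 - 2 * m + m * b + (A - B + m) * (if b = 1 then 1 else 0)) := by
  obtain ⟨hBA, hAB, hA4⟩ := sqrt_diff_lt hN hA hB
  have h2 : 1.41 < √2 := by apply Real.lt_sqrt_of_sq_lt; norm_num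
  have h5 : √5 < 2.24 := by rw [Real.sqrt_lt' (by norm_num)]; norm_num
  have hm0 : 0 < m := by
    have : √2 < 1.5 := by rw [Real.sqrt_lt' (by norm_num)]; norm_num
    by_contra! h
    nlinarith
  have leaf : ∀ c : ℕ, 2 ≤ c → (c : ℝ) ≤ N →
      √(1 + (c : ℝ) ^ 2) ≤ 2 * √2 - 4 * m + m * (1 + c) + (A - B + m) := by
    intro c hc hcN
    have hc' : (2 : ℝ) ≤ c := by exact_mod_cast hc
    have h := mul_sqrt_sq_add_le (q := 1) hc' hcN
    norm_num at h
    rw [← hA] at h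
    rw [add_comm]
    have : 0 < N - 2 := by linarith
    refine le_of_mul_le_mul_left ?_ this
    nlinarith
  rcases eq_or_lt_of_le ha with rfl | ha <;> rcases eq_or_lt_of_le hb with rfl | hb
  · norm_num
    linarith
  · have := leaf b hb hbN
    rw [if_neg (by omega : ¬ b = 1)]
    norm_num
    linarith
  · have := leaf a ha haN
    rw [if_neg (by omega : ¬ a = 1), add_comm ((a : ℝ) ^ 2)]
    norm_num
    linarith
  · rw [if_neg (by omega : ¬ a = 1), if_neg (by omega : ¬ b = 1)]
    have ha' : (2 : ℝ) ≤ a := by exact_mod_cast ha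
    have hb' : (2 : ℝ) ≤ b := by exact_mod_cast hb
    have h := mul_sqrt_sq_add_le (q := 2) (c := a + b - 2) (N := N) (by linarith) (by linarith)
    rw [sqrt_two_sq_add_two_sq, show (2 : ℝ) ^ 2 = 4 by norm_num, ← hB] at h
    have h' : √((a : ℝ) ^ 2 + (b : ℝ) ^ 2) ≤ √(((a : ℝ) + b - 2) ^ 2 + 4) := by
      apply Real.sqrt_le_sqrt
      nlinarith [mul_nonneg (sub_nonneg.2 ha') (sub_nonneg.2 hb')]
    refine h'.trans ?_
    have : 0 < N - 2 := by linarith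
    refine le_of_mul_le_mul_left (h.trans_eq ?_) this
    linear_combination (4 - a - b : ℝ) * hm

end Weight

/-- At least three vertices of a connected unicyclic graph are not leaves. -/
lemma SimpleGraph.card_filter_degree_eq_one_add_three_le {V : Type*} [Fintype V]
    (G : SimpleGraph V) (hV : 2 ≤ Fintype.card V) (hpos : ∀ v, 1 ≤ G.degree v)
    (huni : G.edgeFinset.card = Fintype.card V) :
    (Finset.univ.filter fun v => G.degree v = 1).card + 3 ≤ Fintype.card V := by
  by_contra! hlt
  have hc := Finset.card_filter_add_card_filter_not (s := (Finset.univ : Finset V))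
    (fun v => G.degree v = 1)
  rw [Finset.card_univ] at hc
  obtain ⟨T, hST, hT⟩ := Finset.exists_superset_card_eq
    (s := Finset.univ.filter fun v => ¬ G.degree v = 1) (n := 2) (by omega) hV
  obtain ⟨a, b, hab, rfl⟩ := Finset.card_eq_two.1 hT
  have h1 : ∑ v, (G.degree v - 1) = ∑ v ∈ {a, b}, (G.degree v - 1) := by
    refine (Finset.sum_subset (Finset.subset_univ _) fun v _ hv => ?_).symm
    have : v ∉ Finset.univ.filter fun v => ¬ G.degree v = 1 := fun h => hv (hST h)
    simp at this
    omega
  have h2 : ∑ v, (G.degree v - 1) + Fintype.card V = ∑ v, G.degree v := by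
    rw [← Finset.card_univ, Finset.card_eq_sum_ones, ← Finset.sum_add_distrib]
    exact Finset.sum_congr rfl fun v _ => Nat.sub_add_cancel (hpos v)
  rw [G.sum_degrees_eq_twice_card_edges, h1, Finset.sum_pair hab] at h2
  have := G.degree_add_degree_le_card_edgeFinset_add_one hab
  have := hpos a
  have := hpos b
  omega

lemma somborIndex_le_of_degree_le {V : Type*} [Fintype V] (G : SimpleGraph V) {n : ℕ}
    (hn : 5 ≤ n) (hcard : Fintype.card V = n) (hpos : ∀ v, 1 ≤ G.degree v)
    (huni : G.edgeFinset.card = n) {M : ℕ} (hM : ∀ v, G.degree v ≤ M) {A B m : ℝ}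
    (hA : A = √(((n : ℝ) - 1) ^ 2 + 1)) (hB : B = √(((n : ℝ) - 1) ^ 2 + 4))
    (hm : m * ((n : ℝ) - 3) = B - 2 * √2) (hm0 : 0 < m) {p : ℕ}
    (hp : p = (Finset.univ.filter fun v => G.degree v = 1).card) :
    somborIndex G ≤ n * (2 * √2 - 4 * m) + m * (4 * n + p * ((M : ℝ) - 1)) +
      (A - B + m) * p := by
  have hn' : (5 : ℝ) ≤ n := by exact_mod_cast hn
  set w : V → ℝ := fun u =>
    √2 - 2 * m + m * G.degree u + (A - B + m) * (if G.degree u = 1 then 1 else 0) with hw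
  have h1 : somborIndex G ≤ ∑ u, G.degree u * w u := by
    have : (∑ u : V, ∑ v : V, if G.Adj u v then
        Real.sqrt ((G.degree u : ℝ)^2 + (G.degree v : ℝ)^2) else 0) ≤
        ∑ u : V, ∑ v : V, if G.Adj u v then w u + w v else 0 := by
      refine Finset.sum_le_sum fun u _ => Finset.sum_le_sum fun v _ => ?_
      split_ifs with huv
      · have hlt : ∀ v, (G.degree v : ℝ) ≤ (n : ℝ) - 1 := fun v => by
          have := G.degree_lt_card_verts v
          rw [le_sub_iff_add_le]
          exact_mod_cast (by omega : G.degree v + 1 ≤ n)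
        refine sqrt_sq_add_sq_le_weight (N := n - 1) (by linarith) hA hB (by linarith)
          (hpos u) (hpos v) (hlt u) (hlt v) ?_
        have := G.degree_add_degree_le_card_edgeFinset_add_one huv.ne
        rw [huni] at this
        have : (G.degree u : ℝ) + G.degree v ≤ n + 1 := by exact_mod_cast this
        linarith
      · rfl
    rw [G.sum_sum_ite_adj_add] at this
    unfold somborIndex
    linarith
  have h2 : ∀ u, G.degree u * w u ≤ (√2 - 2 * m + m * (M + 2)) * G.degree u - 2 * m * M +
      (m * ((M : ℝ) - 1) + (A - B + m)) * (if G.degree u = 1 then 1 else 0) := by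
    intro u
    simp only [hw]
    split_ifs with h
    · rw [h]; push_cast; linarith
    · have hd : (2 : ℝ) ≤ G.degree u := by
        have := hpos u
        exact_mod_cast (by omega : 2 ≤ G.degree u)
      have hd' : (G.degree u : ℝ) ≤ M := by exact_mod_cast hM u
      nlinarith [mul_nonneg hm0.le (mul_nonneg (sub_nonneg.2 hd) (sub_nonneg.2 hd'))]
  refine h1.trans ((Finset.sum_le_sum fun u _ => h2 u).trans_eq ?_)
  have hs : ∑ u, (G.degree u : ℝ) = 2 * n := by
    exact_mod_cast huni ▸ G.sum_degrees_eq_twice_card_edges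
  rw [Finset.sum_add_distrib, Finset.sum_sub_distrib, ← Finset.mul_sum, ← Finset.mul_sum,
    ← Finset.mul_sum, hs,
    Finset.sum_boole, ← hp, Finset.sum_const, Finset.card_univ, hcard, nsmul_eq_mul]
  ring

lemma somborIndex_eq_of_iso {V W : Type*} [Fintype V] [Fintype W] {G : SimpleGraph V}
    {H : SimpleGraph W} (e : G ≃g H) : somborIndex G = somborIndex H := by
  unfold somborIndex
  congr 1
  rw [← e.toEquiv.sum_comp]
  refine Finset.sum_congr rfl fun u _ => ?_
  rw [← e.toEquiv.sum_comp]
  refine Finset.sum_congr rfl fun v _ => ?_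
  have h : ∀ x, H.degree (e.toEquiv x) = G.degree x := fun x => e.degree_eq x
  rw [h, h]
  simp [SimpleGraph.Iso.map_adj_iff]

lemma hgraph_one_adj_iff_val {n : ℕ} (u v : Fin n) : (Hgraph n 1).Adj u v ↔
    u.val ≠ v.val ∧ (u.val = 0 ∨ v.val = 0 ∨ u.val = 1 ∧ v.val = 2 ∨ u.val = 2 ∧ v.val = 1) := by
  simp only [Hgraph, SimpleGraph.fromRel_adj, Nat.lt_one_iff, exists_eq_left, Fin.ext_iff, ne_eq]
  omega

lemma hgraph_one_adj {k : ℕ} (u v : Fin (k + 3)) : (Hgraph (k + 3) 1).Adj u v ↔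
    u ≠ v ∧ (u = 0 ∨ v = 0 ∨ u = 1 ∧ v = 2 ∨ u = 2 ∧ v = 1) := by
  simp only [hgraph_one_adj_iff_val, Fin.ext_iff, ne_eq]
  rfl

lemma somborIndex_hgraph_one {n : ℕ} (hn : 5 ≤ n) : somborIndex (Hgraph n 1) =
    ((n : ℝ) - 3) * √(((n : ℝ) - 1) ^ 2 + 1) + 2 * √(((n : ℝ) - 1) ^ 2 + 4) + 2 * √2 := by
  obtain ⟨k, rfl⟩ : ∃ k, n = k + 3 := ⟨n - 3, by omega⟩
  have hdeg : ∀ u, (Hgraph (k + 3) 1).degree u =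
      ∑ v, if (Hgraph (k + 3) 1).Adj u v then 1 else 0 := fun u => by
    rw [← SimpleGraph.card_neighborFinset_eq_degree, SimpleGraph.neighborFinset_eq_filter,
      Finset.card_filter]
  unfold somborIndex
  simp only [hdeg, hgraph_one_adj_iff_val, Fin.sum_univ_succ]
  have h2 : 2 % (k + 3) = 2 := Nat.mod_eq_of_lt (by omega)
  simp [h2]
  rw [add_comm (2 ^ 2) ((1 + (1 + (k : ℝ))) ^ 2), add_comm 1 ((1 + (1 + (k : ℝ))) ^ 2),
    sqrt_two_sq_add_two_sq, show 1 + (1 + (k : ℝ)) = k + 3 - 1 by ring,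
    show (2 : ℝ) ^ 2 = 4 by norm_num]
  ring

lemma nonempty_iso_hgraph_one {V : Type*} [Fintype V] (G : SimpleGraph V) {n : ℕ}
    (hn : 5 ≤ n) (hcard : Fintype.card V = n) (huni : G.edgeFinset.card = n) {c : V}
    (hc : G.degree c = n - 1) : Nonempty (G ≃g Hgraph n 1) := by
  have hcadj : ∀ v, c ≠ v → G.Adj c v := (G.degree_eq_card_sub_one c).1 (by rw [hc, hcard])
  have h1 : (G.edgeFinset \ G.incidenceFinset c).card = 1 := by
    rw [Finset.card_sdiff_of_subset (G.incidenceFinset_subset c),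
      G.card_incidenceFinset_eq_degree, huni, hc]
    omega
  obtain ⟨e, he⟩ := Finset.card_eq_one.1 h1
  induction e with | _ a b => ?_
  have hmem : ∀ u v, G.Adj u v ∧ u ≠ c ∧ v ≠ c ↔ s(u, v) = s(a, b) := by
    intro u v
    rw [← Finset.mem_singleton, ← he]
    simp [SimpleGraph.mem_incidenceFinset, SimpleGraph.mk'_mem_incidenceSet_iff]
    grind
  obtain ⟨hab, hac, hbc⟩ := (hmem a b).2 rfl
  obtain ⟨k, rfl⟩ : ∃ k, n = k + 3 := ⟨n - 3, by omega⟩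
  obtain ⟨f, hfc, hfa, hfb⟩ : ∃ f : V ≃ Fin (k + 3), f c = 0 ∧ f a = 1 ∧ f b = 2 := by
    obtain ⟨f₀⟩ : Nonempty (V ≃ Fin (k + 3)) := ⟨Fintype.equivFinOfCardEq hcard⟩
    let f₁ := f₀.trans (Equiv.swap (f₀ c) 0)
    have h₁c : f₁ c = 0 := by simp [f₁]
    have h₁a : f₁ a ≠ 0 := h₁c ▸ f₁.injective.ne hac
    let f₂ := f₁.trans (Equiv.swap (f₁ a) 1)
    have h₂c : f₂ c = 0 := by
      simpa [f₂, h₁c] using Equiv.swap_apply_of_ne_of_ne h₁a.symm (by simp)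
    have h₂a : f₂ a = 1 := by simp [f₂]
    have h₂b : f₂ b ≠ 0 := h₂c ▸ f₂.injective.ne hbc
    have h₂b' : f₂ b ≠ 1 := h₂a ▸ f₂.injective.ne hab.ne'
    refine ⟨f₂.trans (Equiv.swap (f₂ b) 2), ?_, ?_, by simp⟩
    · simpa [h₂c] using Equiv.swap_apply_of_ne_of_ne h₂b.symm
        (show (0 : Fin (k + 3)) ≠ 2 from
          Fin.ne_of_val_ne (show 0 ≠ 2 by decide))
    · simpa [h₂a] using Equiv.swap_apply_of_ne_of_ne h₂b'.symm
        (show (1 : Fin (k + 3)) ≠ 2 from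
          Fin.ne_of_val_ne (show 1 ≠ 2 by decide))
  refine ⟨⟨f, fun {u v} => ?_⟩⟩
  rw [hgraph_one_adj, ← hfc, ← hfa, ← hfb]
  simp only [f.injective.eq_iff, ne_eq]
  have := hmem u v
  simp only [Sym2.eq_iff] at this
  have huv : G.Adj u v → u ≠ v := fun h => h.ne
  have hab' := hab.ne
  grind [G.adj_comm]

theorem unicyclic_sombor_le {V : Type*} [Fintype V] (G : SimpleGraph V) (n : ℕ)
    (hn : 5 ≤ n) (hcard : Fintype.card V = n) (hconn : G.Connected)
    (huni : G.edgeFinset.card = n) :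
    somborIndex G ≤ ((n : ℝ) - 3) * Real.sqrt (((n : ℝ) - 1)^2 + 1) +
        2 * Real.sqrt (((n : ℝ) - 1)^2 + 4) + 2 * Real.sqrt 2 ∧
    (somborIndex G = ((n : ℝ) - 3) * Real.sqrt (((n : ℝ) - 1)^2 + 1) +
        2 * Real.sqrt (((n : ℝ) - 1)^2 + 4) + 2 * Real.sqrt 2 ↔
      Nonempty (G ≃g Hgraph n 1)) := by
  by_cases hu : ∃ c, G.degree c = n - 1
  · obtain ⟨c, hc⟩ := hu
    have hiso := nonempty_iso_hgraph_one G hn hcard huni hc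
    have heq := (somborIndex_eq_of_iso hiso.some).trans (somborIndex_hgraph_one hn)
    exact ⟨heq.le, fun _ => hiso, fun _ => heq⟩
  push Not at hu
  suffices h : somborIndex G < ((n : ℝ) - 3) * Real.sqrt (((n : ℝ) - 1)^2 + 1) +
      2 * Real.sqrt (((n : ℝ) - 1)^2 + 4) + 2 * Real.sqrt 2 from
    ⟨h.le, fun h' => absurd h' h.ne, fun ⟨e⟩ =>
      (somborIndex_eq_of_iso e).trans (somborIndex_hgraph_one hn)⟩
  have : Nontrivial V := Fintype.one_lt_card_iff_nontrivial.1 (by omega)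
  have hpos : ∀ v, 1 ≤ G.degree v := fun v => hconn.preconnected.degree_pos_of_nontrivial v
  have hM : ∀ v, G.degree v ≤ n - 2 := fun v => by
    have := G.degree_lt_card_verts v
    have := hu v
    omega
  have hn' : (5 : ℝ) ≤ n := by exact_mod_cast hn
  have hp := G.card_filter_degree_eq_one_add_three_le (by omega) hpos (huni.trans hcard.symm)
  rw [hcard] at hp
  set p := (Finset.univ.filter fun v => G.degree v = 1).card with hpdef
  set A := √(((n : ℝ) - 1) ^ 2 + 1) with hA
  set B := √(((n : ℝ) - 1) ^ 2 + 4) with hB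
  obtain ⟨hBA, hAB, hA4⟩ := sqrt_diff_lt (N := n - 1) (by linarith) hA hB
  obtain ⟨m, hm⟩ : ∃ m : ℝ, m * ((n : ℝ) - 3) = B - 2 * √2 :=
    ⟨(B - 2 * √2) / (n - 3), div_mul_cancel₀ _ (by linarith)⟩
  have hm58 : 0.58 < m := by
    have h2 : √2 < 1.415 := by rw [Real.sqrt_lt' (by norm_num)]; norm_num
    have hB' : (n : ℝ) - 1 ≤ B := by apply Real.le_sqrt_of_sq_le; linarith
    by_contra! h
    nlinarith
  have hmain := somborIndex_le_of_degree_le G hn hcard hpos huni hM hA hB hm (by linarith) hpdef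
  rw [Nat.cast_sub (by omega)] at hmain
  have hp' : (p : ℝ) ≤ n - 3 := by
    rw [le_sub_iff_add_le]; exact_mod_cast hp
  push_cast at hmain
  have e1 : (A - B + m) * p ≤ (A - B + m) * (n - 3) :=
    mul_le_mul_of_nonneg_left hp' (by linarith)
  have e2 : m * (p * ((n : ℝ) - 2 - 1)) < m * ((n - 3) * (n - 2)) := by
    apply mul_lt_mul_of_pos_left _ (by linarith)
    nlinarith
  nlinarith
end

section
/- Let G be a tree on 2β vertices (β ≥ 2) that has a perfect matching. Then SO(G) ≤ (β−1)√(β²+4) + √(β²+1) + √5·(β−1), with equality if and only if G ≅ H*(2β,0), the tree obtained from a star K_{1,β} by attaching a pendant edge to β−1 of the pendant vertices of K_{1,β}. -/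
attribute [local instance] Classical.propDecidable

namespace PerfectMatchingSombor

section RealBounds

theorem sq_add_sq_le {x y b : ℕ} (hx : 2 ≤ x) (hy : 2 ≤ y) (h : x + y ≤ b + 2) :
    x ^ 2 + y ^ 2 ≤ b ^ 2 + 4 := by
  obtain ⟨p, rfl⟩ := Nat.exists_eq_add_of_le hx
  obtain ⟨q, rfl⟩ := Nat.exists_eq_add_of_le hy
  have : p + q + 2 ≤ b := by omega
  nlinarith [Nat.zero_le (p * q), Nat.mul_le_mul this this]

theorem sq_add_sq_lt {x y b : ℕ} (hx : 2 ≤ x) (hy : 2 ≤ y) (h : x + y ≤ b + 2)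
    (hxb : x ≠ b) (hyb : y ≠ b) : x ^ 2 + y ^ 2 < b ^ 2 + 4 := by
  obtain ⟨p, rfl⟩ := Nat.exists_eq_add_of_le hx
  obtain ⟨q, rfl⟩ := Nat.exists_eq_add_of_le hy
  obtain ⟨r, rfl⟩ := Nat.exists_eq_add_of_le (show p + q + 2 ≤ b by omega)
  rcases Nat.eq_zero_or_pos r with rfl | hr
  · have hp : 0 < p := by omega
    have hq : 0 < q := by omega
    nlinarith [Nat.mul_pos hp hq]
  · nlinarith [Nat.zero_le (p * q), Nat.zero_le (r * p), Nat.zero_le (r * q),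
      Nat.zero_le (r * r)]

/-- `k ↦ √((k + 1)² + 1)` lies below its chord between `k = 1` and `k = b - 1`. -/
theorem sqrt_le_chord {x y b t : ℝ} (hx : 1 ≤ x) (hy : 1 ≤ y)
    (ht0 : 0 ≤ t) (ht1 : t ≤ 1) (h : x + y - 1 = (1 - t) * 2 + t * b) :
    √(x ^ 2 + y ^ 2) ≤ (1 - t) * √5 + t * √(b ^ 2 + 1) := by
  have hs : 0 ≤ 1 - t := by linarith
  have h5 : √5 ^ 2 = 5 := Real.sq_sqrt (by norm_num)
  have hB : √(b ^ 2 + 1) ^ 2 = b ^ 2 + 1 := Real.sq_sqrt (by positivity)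
  have hc : 2 * b + 1 ≤ √5 * √(b ^ 2 + 1) := by
    rw [← Real.sqrt_mul (by norm_num)]
    apply Real.le_sqrt_of_sq_le
    nlinarith [sq_nonneg (b - 2)]
  have hxy : x ^ 2 + y ^ 2 ≤ (x + y - 1) ^ 2 + 1 := by nlinarith
  apply Real.sqrt_le_iff.mpr
  refine ⟨by positivity, hxy.trans ?_⟩
  have := mul_le_mul_of_nonneg_left hc (mul_nonneg ht0 hs)
  rw [h]
  have hexp : ((1 - t) * √5 + t * √(b ^ 2 + 1)) ^ 2 =
      (1 - t) ^ 2 * 5 + t ^ 2 * (b ^ 2 + 1) + 2 * (t * (1 - t) * (√5 * √(b ^ 2 + 1))) := by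
    linear_combination (1 - t) ^ 2 * h5 + t ^ 2 * hB
  rw [hexp]
  linarith

end RealBounds

section Matching

variable {V : Type*} [Fintype V]

/-- The graph obtained from `G` by removing the edges `v — m v` of a matching involution `m`. -/
def offMatching (G : SimpleGraph V) (m : V → V) (hm : ∀ v, m (m v) = v) : SimpleGraph V where
  Adj u v := G.Adj u v ∧ v ≠ m u
  symm := ⟨fun u v h => ⟨h.1.symm, fun e => h.2 (by rw [e, hm])⟩⟩
  loopless := ⟨fun u h => G.loopless.irrefl u h.1⟩

omit [Fintype V] in
@[simp]
theorem offMatching_adj {G : SimpleGraph V} {m : V → V} (hm : ∀ v, m (m v) = v) {u v : V} :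
    (offMatching G m hm).Adj u v ↔ G.Adj u v ∧ v ≠ m u := Iff.rfl

omit [Fintype V] in
theorem exists_matching_involution {G : SimpleGraph V}
    (hpm : ∃ M : G.Subgraph, M.IsPerfectMatching) :
    ∃ m : V → V, (∀ v, m (m v) = v) ∧ ∀ v, G.Adj v (m v) := by
  obtain ⟨M, hM, hS⟩ := hpm
  choose m hm hu using fun v => hM (hS v)
  exact ⟨m, fun v => (hu (m v) v (hm v).symm).symm, fun v => (hm v).adj_sub⟩

variable {G : SimpleGraph V} {m : V → V} (hm : ∀ v, m (m v) = v)

theorem degree_eq (hadj : ∀ v, G.Adj v (m v)) (v : V) :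
    G.degree v = (offMatching G m hm).degree v + 1 := by
  have : G.neighborFinset v = insert (m v) ((offMatching G m hm).neighborFinset v) := by
    ext w
    simp only [SimpleGraph.mem_neighborFinset, Finset.mem_insert, offMatching_adj]
    have := hadj v
    by_cases h : w = m v <;> simp_all
  rw [← SimpleGraph.card_neighborFinset_eq_degree, this, Finset.card_insert_of_notMem,
    SimpleGraph.card_neighborFinset_eq_degree]
  simp

theorem sum_degree_offMatching (hadj : ∀ v, G.Adj v (m v)) {β : ℕ}
    (hcard : Fintype.card V = 2 * β) (hT : G.IsTree) :
    ∑ v, (offMatching G m hm).degree v = 2 * (β - 1) := by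
  have h1 := G.sum_degrees_eq_twice_card_edges
  have h2 := hT.card_edgeFinset
  simp only [degree_eq hm hadj, Finset.sum_add_distrib, Finset.sum_const, Finset.card_univ,
    smul_eq_mul] at h1
  omega

theorem degree_add_degree_le (N : SimpleGraph V) {u v : V} (h : u ≠ v) :
    N.degree u + N.degree v ≤ N.edgeFinset.card + if N.Adj u v then 1 else 0 := by
  rw [← N.card_incidenceFinset_eq_degree u, ← N.card_incidenceFinset_eq_degree v,
    ← Finset.card_union_add_card_inter]
  gcongr
  · intro e he
    rcases Finset.mem_union.mp he with he | he <;>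
      exact SimpleGraph.incidenceFinset_subset _ _ he
  · split_ifs with ha
    · rw [← Finset.card_singleton s(u, v)]
      apply Finset.card_le_card
      intro e he
      simp only [Finset.mem_inter, SimpleGraph.mem_incidenceFinset] at he
      simpa using N.incidenceSet_inter_incidenceSet_subset h he
    · rw [Nat.le_zero, Finset.card_eq_zero, Finset.eq_empty_iff_forall_notMem]
      intro e he
      simp only [Finset.mem_inter, SimpleGraph.mem_incidenceFinset] at he
      have := N.incidenceSet_inter_incidenceSet_of_not_adj ha h
      exact (this ▸ (show e ∈ N.incidenceSet u ∩ N.incidenceSet v from he) : e ∈ (∅ : Set _))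

theorem adj_imp_of_card_edgeFinset_le_degree (N : SimpleGraph V) {c : V}
    (h : N.edgeFinset.card ≤ N.degree c) {u v : V} (huv : N.Adj u v) : u = c ∨ v = c := by
  have he : N.incidenceFinset c = N.edgeFinset :=
    Finset.eq_of_subset_of_card_le (SimpleGraph.incidenceFinset_subset _ _)
      (by rwa [N.card_incidenceFinset_eq_degree])
  have : s(u, v) ∈ N.incidenceFinset c := by rw [he]; simpa using huv
  rw [SimpleGraph.mem_incidenceFinset] at this
  have := this.2
  simp only [Sym2.mem_iff] at this
  tauto

theorem one_le_degree_add_degree (hc : G.Connected)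
    (hcard : 2 < Fintype.card V) (u : V) :
    1 ≤ (offMatching G m hm).degree u + (offMatching G m hm).degree (m u) := by
  by_contra! h
  have h1 : (offMatching G m hm).degree u = 0 := by omega
  have h2 : (offMatching G m hm).degree (m u) = 0 := by omega
  rw [SimpleGraph.degree_eq_zero] at h1 h2
  obtain ⟨w, hw⟩ : ∃ w, w ∉ ({u, m u} : Finset V) := by
    by_contra! hall
    have := Finset.card_le_card (fun x _ => hall x : Finset.univ ⊆ ({u, m u} : Finset V))
    have := Finset.card_le_two (a := u) (b := m u)
    rw [Finset.card_univ] at *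
    omega
  obtain ⟨p⟩ := hc.preconnected u w
  obtain ⟨d, -, hd1, hd2⟩ := p.exists_boundary_dart (↑({u, m u} : Finset V)) (by simp) hw
  have hd := d.adj
  simp only [Finset.coe_insert, Finset.coe_singleton, Set.mem_insert_iff,
    Set.mem_singleton_iff, not_or] at hd1 hd2
  rcases hd1 with e | e
  · rw [e] at hd
    exact h1 _ ⟨hd, hd2.2⟩
  · rw [e] at hd
    exact h2 _ ⟨hd, by rw [hm]; exact hd2.1⟩

theorem two_mul_somborIndex (hadj : ∀ v, G.Adj v (m v)) :
    2 * somborIndex G = ∑ u, √((G.degree u : ℝ) ^ 2 + (G.degree (m u) : ℝ) ^ 2) +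
      ∑ u, ∑ v ∈ (offMatching G m hm).neighborFinset u,
        √((G.degree u : ℝ) ^ 2 + (G.degree v : ℝ) ^ 2) := by
  rw [somborIndex, mul_div_cancel₀ _ two_ne_zero, ← Finset.sum_add_distrib]
  refine Finset.sum_congr rfl fun u _ => ?_
  rw [← Finset.sum_filter, ← Finset.sum_insert (a := m u)
    (f := fun v => √((G.degree u : ℝ) ^ 2 + (G.degree v : ℝ) ^ 2))]
  · refine Finset.sum_congr ?_ fun _ _ => rfl
    ext v
    have := hadj u
    by_cases h : v = m u <;> simp_all
  · simp

end Matching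

section Extremal

variable {V : Type*} [Fintype V] {G : SimpleGraph V} {m : V → V} (hm : ∀ v, m (m v) = v)
  (hadj : ∀ v, G.Adj v (m v)) {β : ℕ} (hβ : 2 ≤ β) (hcard : Fintype.card V = 2 * β)
  (hT : G.IsTree)

include hadj hcard hT in
theorem card_edgeFinset_offMatching : (offMatching G m hm).edgeFinset.card = β - 1 := by
  have h1 := sum_degree_offMatching hm hadj hcard hT
  have h2 := (offMatching G m hm).sum_degrees_eq_twice_card_edges
  omega

include hm hadj hcard hT in
theorem degree_add_degree_partner_le (u : V) : G.degree u + G.degree (m u) ≤ β + 1 := by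
  have h := degree_add_degree_le (offMatching G m hm) (hadj u).ne
  have h2 : 0 < Fintype.card V := Fintype.card_pos_iff.mpr ⟨u⟩
  rw [card_edgeFinset_offMatching hm hadj hcard hT, if_neg (by simp)] at h
  rw [degree_eq hm hadj u, degree_eq hm hadj (m u)]
  omega

include hadj hcard hT in
theorem degree_add_degree_le_of_offMatching_adj {u v : V} (huv : (offMatching G m hm).Adj u v) :
    G.degree u + G.degree v ≤ β + 2 := by
  have h := degree_add_degree_le (offMatching G m hm) huv.ne
  have h2 : 0 < Fintype.card V := Fintype.card_pos_iff.mpr ⟨u⟩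
  rw [card_edgeFinset_offMatching hm hadj hcard hT, if_pos huv] at h
  rw [degree_eq hm hadj u, degree_eq hm hadj v]
  omega

include hadj in
theorem two_le_degree_of_offMatching_adj {u v : V} (huv : (offMatching G m hm).Adj u v) :
    2 ≤ G.degree u := by
  have : 0 < (offMatching G m hm).degree u :=
    (SimpleGraph.degree_pos_iff_exists_adj _ _).mpr ⟨v, huv⟩
  rw [degree_eq hm hadj u]
  omega

include hm hadj hβ hcard hT in
/-- The matching edges, each counted twice, contribute at most `2 (√(β² + 1) + (β - 1) √5)`. -/
theorem sum_matching_le :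
    ∑ u, √((G.degree u : ℝ) ^ 2 + (G.degree (m u) : ℝ) ^ 2) ≤
      2 * (√((β : ℝ) ^ 2 + 1) + ((β : ℝ) - 1) * √5) := by
  have hβ' : (2 : ℝ) ≤ β := by exact_mod_cast hβ
  have hk (u : V) : 3 ≤ G.degree u + G.degree (m u) := by
    have := one_le_degree_add_degree hm hT.1 (by omega) u
    rw [degree_eq hm hadj u, degree_eq hm hadj (m u)]
    omega
  have hsum : ∑ u, (G.degree u + G.degree (m u) : ℝ) = 8 * β - 4 := by
    have h1 : ∑ u, G.degree (m u) = ∑ u, G.degree u :=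
      Equiv.sum_comp (Function.Involutive.toPerm m hm) fun u => G.degree u
    have h2 : ∑ u, G.degree u + 2 = 4 * β := by
      have h3 := G.sum_degrees_eq_twice_card_edges
      have h4 := hT.card_edgeFinset
      omega
    rw [Finset.sum_add_distrib, ← Nat.cast_sum, ← Nat.cast_sum, h1]
    have : ((∑ u, G.degree u : ℕ) : ℝ) + 2 = 4 * β := by exact_mod_cast h2
    linarith
  have hpt (u : V) : √((G.degree u : ℝ) ^ 2 + (G.degree (m u) : ℝ) ^ 2) ≤
      √5 + ((G.degree u + G.degree (m u) : ℝ) - 3) *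
        ((√((β : ℝ) ^ 2 + 1) - √5) / (β - 2)) := by
    have hle := degree_add_degree_partner_le hm hadj hcard hT u
    have hk' : (3 : ℝ) ≤ G.degree u + G.degree (m u) := by exact_mod_cast hk u
    have hle' : (G.degree u + G.degree (m u) : ℝ) ≤ β + 1 := by exact_mod_cast hle
    have h1 : (1 : ℝ) ≤ G.degree u := by rw [degree_eq hm hadj u]; simp
    have h2 : (1 : ℝ) ≤ G.degree (m u) := by rw [degree_eq hm hadj (m u)]; simp
    have := sqrt_le_chord (b := β) (t := ((G.degree u + G.degree (m u) : ℝ) - 3) / (β - 2))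
      h1 h2 (div_nonneg (by linarith) (by linarith))
      (div_le_one_of_le₀ (by linarith) (by linarith)) (by
        rcases hβ'.eq_or_lt with h | h
        · rw [← h] at hle' ⊢
          simp
          linarith
        · have : (β : ℝ) - 2 ≠ 0 := by linarith
          field_simp
          ring)
    refine this.trans (le_of_eq ?_)
    ring
  refine (Finset.sum_le_sum fun u _ => hpt u).trans (le_of_eq ?_)
  rw [Finset.sum_add_distrib, ← Finset.sum_mul, Finset.sum_sub_distrib, hsum]
  simp only [Finset.sum_const, Finset.card_univ, hcard, nsmul_eq_mul]
  push_cast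
  rcases hβ'.eq_or_lt with h | h
  · rw [← h]
    norm_num
    ring
  · have : (β : ℝ) - 2 ≠ 0 := by linarith
    field_simp
    ring

include hadj hcard hT in
theorem sqrt_le_of_offMatching_adj {u v : V} (huv : (offMatching G m hm).Adj u v) :
    √((G.degree u : ℝ) ^ 2 + (G.degree v : ℝ) ^ 2) ≤ √((β : ℝ) ^ 2 + 4) := by
  apply Real.sqrt_le_sqrt
  exact_mod_cast sq_add_sq_le (two_le_degree_of_offMatching_adj hm hadj huv)
    (two_le_degree_of_offMatching_adj hm hadj huv.symm)
    (degree_add_degree_le_of_offMatching_adj hm hadj hcard hT huv)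

include hadj hβ hcard hT in
theorem sum_sum_const_offMatching :
    ∑ u, ∑ _v ∈ (offMatching G m hm).neighborFinset u, √((β : ℝ) ^ 2 + 4) =
      2 * (((β : ℝ) - 1) * √((β : ℝ) ^ 2 + 4)) := by
  simp only [Finset.sum_const, SimpleGraph.card_neighborFinset_eq_degree, nsmul_eq_mul]
  rw [← Finset.sum_mul, ← Nat.cast_sum, sum_degree_offMatching hm hadj hcard hT]
  push_cast [show 1 ≤ β by omega]
  ring

include hm hadj hβ hcard hT in
theorem somborIndex_le :
    somborIndex G ≤ ((β : ℝ) - 1) * √((β : ℝ) ^ 2 + 4) + √((β : ℝ) ^ 2 + 1) +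
      √5 * ((β : ℝ) - 1) := by
  have h1 := two_mul_somborIndex hm hadj
  have h2 := sum_matching_le hm hadj hβ hcard hT
  have h3 : ∑ u, ∑ v ∈ (offMatching G m hm).neighborFinset u,
      √((G.degree u : ℝ) ^ 2 + (G.degree v : ℝ) ^ 2) ≤
      ∑ u, ∑ _v ∈ (offMatching G m hm).neighborFinset u, √((β : ℝ) ^ 2 + 4) := by
    refine Finset.sum_le_sum fun u _ => Finset.sum_le_sum fun v hv => ?_
    exact sqrt_le_of_offMatching_adj hm hadj hcard hT (by simpa using hv)
  rw [sum_sum_const_offMatching hm hadj hβ hcard hT] at h3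
  linarith

include hm hadj hβ hcard hT in
theorem somborIndex_lt (hdeg : ∀ c, G.degree c ≠ β) :
    somborIndex G < ((β : ℝ) - 1) * √((β : ℝ) ^ 2 + 4) + √((β : ℝ) ^ 2 + 1) +
      √5 * ((β : ℝ) - 1) := by
  have h1 := two_mul_somborIndex hm hadj
  have h2 := sum_matching_le hm hadj hβ hcard hT
  have hlt {u v : V} (huv : (offMatching G m hm).Adj u v) :
      √((G.degree u : ℝ) ^ 2 + (G.degree v : ℝ) ^ 2) < √((β : ℝ) ^ 2 + 4) := by
    apply Real.sqrt_lt_sqrt (by positivity)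
    exact_mod_cast sq_add_sq_lt (two_le_degree_of_offMatching_adj hm hadj huv)
      (two_le_degree_of_offMatching_adj hm hadj huv.symm)
      (degree_add_degree_le_of_offMatching_adj hm hadj hcard hT huv) (hdeg u) (hdeg v)
  obtain ⟨u, hu⟩ : ∃ u, 0 < (offMatching G m hm).degree u := by
    by_contra! h
    have := sum_degree_offMatching hm hadj hcard hT
    rw [Finset.sum_eq_zero fun u _ => Nat.le_zero.mp (h u)] at this
    omega
  have h3 : ∑ u, ∑ v ∈ (offMatching G m hm).neighborFinset u,
      √((G.degree u : ℝ) ^ 2 + (G.degree v : ℝ) ^ 2) <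
      ∑ u, ∑ _v ∈ (offMatching G m hm).neighborFinset u, √((β : ℝ) ^ 2 + 4) := by
    refine Finset.sum_lt_sum (fun u _ => Finset.sum_le_sum fun v hv => (hlt (by simpa using hv)).le)
      ⟨u, Finset.mem_univ u, Finset.sum_lt_sum_of_nonempty ?_
        fun v hv => hlt (by simpa using hv)⟩
    rwa [← Finset.card_pos, SimpleGraph.card_neighborFinset_eq_degree]
  rw [sum_sum_const_offMatching hm hadj hβ hcard hT] at h3
  linarith

variable {c : V} (hc : G.degree c = β)

include hadj hcard hT hc in
theorem eq_or_eq_of_offMatching_adj {u v : V} (huv : (offMatching G m hm).Adj u v) :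
    u = c ∨ v = c := by
  apply adj_imp_of_card_edgeFinset_le_degree _ _ huv
  rw [card_edgeFinset_offMatching hm hadj hcard hT]
  have := degree_eq hm hadj c
  omega

include hadj hcard hT hc in
theorem offMatching_degree_le_one {v : V} (hv : v ≠ c) : (offMatching G m hm).degree v ≤ 1 := by
  rw [← SimpleGraph.card_neighborFinset_eq_degree, ← Finset.card_singleton c]
  refine Finset.card_le_card fun w hw => ?_
  rw [SimpleGraph.mem_neighborFinset] at hw
  simpa using (eq_or_eq_of_offMatching_adj hm hadj hcard hT hc hw).resolve_left hv

include hm hadj hcard hT hc in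
theorem degree_partner_center : G.degree (m c) = 1 := by
  have h1 := degree_eq hm hadj (m c)
  have h2 := degree_add_degree_partner_le hm hadj hcard hT c
  omega

include hm hadj hβ hcard hT hc in
theorem le_somborIndex :
    ((β : ℝ) - 1) * √((β : ℝ) ^ 2 + 4) + √((β : ℝ) ^ 2 + 1) + √5 * ((β : ℝ) - 1) ≤
      somborIndex G := by
  have h1 := two_mul_somborIndex hm hadj
  have hmc := degree_partner_center hm hadj hcard hT hc
  have hnb {u v : V} (huv : (offMatching G m hm).Adj u v) (hu : u = c) : G.degree v = 2 := by
    have h3 := offMatching_degree_le_one hm hadj hcard hT hc (v := v) (hu ▸ huv.ne')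
    have h4 := two_le_degree_of_offMatching_adj hm hadj huv.symm
    have := degree_eq hm hadj v
    omega
  have h2 : ∑ u, ∑ v ∈ (offMatching G m hm).neighborFinset u,
      √((G.degree u : ℝ) ^ 2 + (G.degree v : ℝ) ^ 2) =
      ∑ u, ∑ _v ∈ (offMatching G m hm).neighborFinset u, √((β : ℝ) ^ 2 + 4) := by
    refine Finset.sum_congr rfl fun u _ => Finset.sum_congr rfl fun v hv => ?_
    rw [SimpleGraph.mem_neighborFinset] at hv
    rcases eq_or_eq_of_offMatching_adj hm hadj hcard hT hc hv with e | e
    · rw [hnb hv e, e, hc]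
      norm_num
    · rw [hnb hv.symm e, e, hc, add_comm]
      norm_num
  have hne : c ≠ m c := (hadj c).ne
  have h3 : ∑ u ∈ Finset.univ \ {c, m c}, √5 + ∑ u ∈ {c, m c}, √((β : ℝ) ^ 2 + 1) ≤
      ∑ u, √((G.degree u : ℝ) ^ 2 + (G.degree (m u) : ℝ) ^ 2) := by
    rw [← Finset.sum_sdiff (Finset.subset_univ {c, m c})]
    refine add_le_add (Finset.sum_le_sum fun u _ => Real.sqrt_le_sqrt ?_)
      (Finset.sum_le_sum fun u hu => Real.sqrt_le_sqrt ?_)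
    · have h4 := one_le_degree_add_degree hm hT.1 (by omega) u
      have h5 := degree_eq hm hadj u
      have h6 := degree_eq hm hadj (m u)
      have : 5 ≤ G.degree u ^ 2 + G.degree (m u) ^ 2 := by
        rcases (by omega : 2 ≤ G.degree u ∧ 1 ≤ G.degree (m u) ∨
          1 ≤ G.degree u ∧ 2 ≤ G.degree (m u)) with h | h <;> nlinarith
      exact_mod_cast this
    · have h : G.degree u ^ 2 + G.degree (m u) ^ 2 = β ^ 2 + 1 := by
        rcases Finset.mem_insert.mp hu with e | e
        · rw [e, hc, hmc]
          norm_num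
        · rw [Finset.mem_singleton.mp e, hm, hc, hmc, add_comm]
          norm_num
      exact_mod_cast h.ge
  rw [Finset.sum_const, Finset.sum_const, Finset.card_univ_sdiff, Finset.card_pair hne, hcard] at h3
  rw [sum_sum_const_offMatching hm hadj hβ hcard hT] at h2
  push_cast [nsmul_eq_mul, show 2 ≤ 2 * β by omega] at h3
  linarith

include hadj hcard hT hβ hc in
theorem eq_or_adj_center (u : V) :
    (u = c ∨ (offMatching G m hm).Adj c u) ∨ (m u = c ∨ (offMatching G m hm).Adj c (m u)) := by
  have h := one_le_degree_add_degree hm hT.1 (by omega) u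
  have key {v : V} (hv : 0 < (offMatching G m hm).degree v) :
      v = c ∨ (offMatching G m hm).Adj c v := by
    obtain ⟨w, hw⟩ := (SimpleGraph.degree_pos_iff_exists_adj _ _).mp hv
    refine (eq_or_eq_of_offMatching_adj hm hadj hcard hT hc hw).imp_right fun e => ?_
    exact e ▸ hw.symm
  rcases Nat.eq_zero_or_pos ((offMatching G m hm).degree u) with h0 | h0
  · exact Or.inr (key (by omega))
  · exact Or.inl (key h0)

include hm hadj hβ hcard hT hc in
theorem nonempty_iso_HstarGraph : Nonempty (G ≃g HstarGraph β 0) := by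
  obtain ⟨a, ha0, ha⟩ : ∃ a : ℕ → V, a 0 = c ∧
      ∀ v, (offMatching G m hm).Adj c v ↔ ∃ i, 1 ≤ i ∧ i < β ∧ a i = v := by
    have hd : ((offMatching G m hm).neighborFinset c).card = β - 1 := by
      have := degree_eq hm hadj c
      rw [SimpleGraph.card_neighborFinset_eq_degree]
      omega
    let e := Finset.equivFinOfCardEq hd
    refine ⟨fun i => if h : 1 ≤ i ∧ i < β then e.symm ⟨i - 1, by omega⟩ else c, by simp,
      fun v => ⟨fun hv => ?_, ?_⟩⟩
    · let j := e ⟨v, by simpa using hv⟩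
      refine ⟨j + 1, by omega, by omega, ?_⟩
      have : (j : ℕ) + 1 < β := by omega
      simp [this, j]
    · rintro ⟨i, h1, h2, rfl⟩
      have := (e.symm ⟨i - 1, by omega⟩).2
      rw [SimpleGraph.mem_neighborFinset] at this
      simpa [h1, h2] using this
  let f : Fin (2 * β) → V := fun x => if x.1 < β then a x else m (a (x - β))
  have hcov (u : V) (hu : u = c ∨ (offMatching G m hm).Adj c u) : ∃ i < β, a i = u := by
    rcases hu with rfl | hu
    · exact ⟨0, by omega, ha0⟩
    · obtain ⟨i, -, hi, e⟩ := (ha u).mp hu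
      exact ⟨i, hi, e⟩
  have hsurj : Function.Surjective f := by
    intro u
    rcases eq_or_adj_center hm hadj hβ hcard hT hc u with h | h
    · obtain ⟨i, hi, e⟩ := hcov u h
      exact ⟨⟨i, by omega⟩, by simp [f, hi, e]⟩
    · obtain ⟨i, hi, e⟩ := hcov _ h
      exact ⟨⟨β + i, by omega⟩, by simp [f, e, hm]⟩
  have hbij : Function.Bijective f :=
    (Fintype.bijective_iff_surjective_and_card f).mpr ⟨hsurj, by simp [hcard]⟩
  have hf0 (x : Fin (2 * β)) : f x = c ↔ x.1 = 0 := by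
    have h0 : f ⟨0, by omega⟩ = c := by simp [f, ha0, show 0 < β by omega]
    rw [← h0, hbij.1.eq_iff, Fin.ext_iff]
  have hfc (x : Fin (2 * β)) : (offMatching G m hm).Adj c (f x) ↔ 1 ≤ x.1 ∧ x.1 < β := by
    rw [ha]
    constructor
    · rintro ⟨i, h1, h2, e⟩
      have : f ⟨i, by omega⟩ = f x := by rw [← e]; simp [f, h2]
      rw [← hbij.1 this]
      exact ⟨h1, h2⟩
    · rintro ⟨h1, h2⟩
      exact ⟨x, h1, h2, by simp [f, h2]⟩
  have hfm (x y : Fin (2 * β)) : f y = m (f x) ↔ y.1 = x.1 + β ∨ x.1 = y.1 + β := by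
    by_cases hx : x.1 < β
    · have : m (f x) = f ⟨x + β, by omega⟩ := by simp [f, hx]
      rw [this, hbij.1.eq_iff, Fin.ext_iff]
      simp only
      omega
    · have : m (f x) = f ⟨x - β, by omega⟩ := by
        have : x.1 - β < β := by omega
        simp [f, hx, this, hm]
      rw [this, hbij.1.eq_iff, Fin.ext_iff]
      simp only
      omega
  have hG (u v : V) : G.Adj u v ↔ v = m u ∨ (u = c ∧ (offMatching G m hm).Adj c v) ∨
      (v = c ∧ (offMatching G m hm).Adj c u) := by
    constructor
    · intro h
      by_cases hv : v = m u
      · exact Or.inl hv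
      · have hN : (offMatching G m hm).Adj u v := ⟨h, hv⟩
        rcases eq_or_eq_of_offMatching_adj hm hadj hcard hT hc hN with rfl | rfl
        · exact Or.inr (Or.inl ⟨rfl, hN⟩)
        · exact Or.inr (Or.inr ⟨rfl, hN.symm⟩)
    · rintro (rfl | ⟨rfl, h⟩ | ⟨rfl, h⟩)
      · exact hadj u
      · exact h.1
      · exact h.1.symm
  refine ⟨RelIso.symm ⟨Equiv.ofBijective f hbij, fun {x y} => ?_⟩⟩
  rw [Equiv.ofBijective_apply, Equiv.ofBijective_apply, hG, hfm, hf0, hf0, hfc, hfc, HstarGraph,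
    SimpleGraph.fromRel_adj, Ne, Fin.ext_iff]
  have hx := x.2
  have hy := y.2
  constructor
  · rintro ((h | h) | h | h)
    · refine ⟨by omega, Or.inl ?_⟩
      rcases Nat.eq_zero_or_pos x.1 with h0 | h0
      · exact Or.inl (by omega)
      · exact Or.inr (Or.inr ⟨x, by omega⟩)
    · refine ⟨by omega, Or.inr ?_⟩
      rcases Nat.eq_zero_or_pos y.1 with h0 | h0
      · exact Or.inl (by omega)
      · exact Or.inr (Or.inr ⟨y, by omega⟩)
    · exact ⟨by omega, Or.inl (Or.inl (by omega))⟩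
    · exact ⟨by omega, Or.inr (Or.inl (by omega))⟩
  · rintro ⟨-, (h | ⟨k, h, -⟩ | ⟨j, h⟩) | (h | ⟨k, h, -⟩ | ⟨j, h⟩)⟩ <;> omega

end Extremal

theorem degree_HstarGraph_zero {β : ℕ} (hβ : 2 ≤ β) :
    (HstarGraph β 0).degree ⟨0, by omega⟩ = β := by
  have h : ((HstarGraph β 0).neighborFinset ⟨0, by omega⟩).map Fin.valEmbedding =
      Finset.Icc 1 β := by
    ext i
    simp only [Finset.mem_map, SimpleGraph.mem_neighborFinset]
    simp only [HstarGraph, SimpleGraph.fromRel_adj, Fin.valEmbedding_apply, Finset.mem_Icc, Ne, Fin.ext_iff]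
    constructor
    · rintro ⟨x, ⟨-, (h | ⟨k, h, -⟩ | ⟨j, h⟩) | (h | ⟨k, h, -⟩ | ⟨j, h⟩)⟩, rfl⟩ <;> omega
    · rintro h
      exact ⟨⟨i, by omega⟩, ⟨by simp only; omega, Or.inl (Or.inl ⟨trivial, h.1, h.2⟩)⟩, rfl⟩
  rw [← SimpleGraph.card_neighborFinset_eq_degree, ← Finset.card_map Fin.valEmbedding, h,
    Nat.card_Icc]
  omega

end PerfectMatchingSombor

theorem tree_pm_sombor_le {V : Type*} [Fintype V] (G : SimpleGraph V) (β : ℕ)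
    (hβ : 2 ≤ β) (hcard : Fintype.card V = 2 * β) (hT : G.IsTree)
    (hpm : ∃ M : G.Subgraph, M.IsPerfectMatching) :
    somborIndex G ≤ ((β : ℝ) - 1) * Real.sqrt ((β : ℝ)^2 + 4) +
        Real.sqrt ((β : ℝ)^2 + 1) + Real.sqrt 5 * ((β : ℝ) - 1) ∧
    (somborIndex G = ((β : ℝ) - 1) * Real.sqrt ((β : ℝ)^2 + 4) +
        Real.sqrt ((β : ℝ)^2 + 1) + Real.sqrt 5 * ((β : ℝ) - 1) ↔
      Nonempty (G ≃g HstarGraph β 0)) := by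
  obtain ⟨m, hm, hadj⟩ := PerfectMatchingSombor.exists_matching_involution hpm
  have hle := PerfectMatchingSombor.somborIndex_le hm hadj hβ hcard hT
  refine ⟨hle, fun h => ?_, fun ⟨φ⟩ => ?_⟩
  · obtain ⟨c, hc⟩ : ∃ c, G.degree c = β := by
      by_contra! hdeg
      exact (PerfectMatchingSombor.somborIndex_lt hm hadj hβ hcard hT hdeg).ne h
    exact PerfectMatchingSombor.nonempty_iso_HstarGraph hm hadj hβ hcard hT hc
  · refine hle.antisymm (PerfectMatchingSombor.le_somborIndex hm hadj hβ hcard hT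
      (c := φ.symm ⟨0, by omega⟩) ?_)
    rw [φ.symm.degree_eq, PerfectMatchingSombor.degree_HstarGraph_zero hβ]
end

section
/- Let G be a connected unicyclic graph on 2β vertices (β ≥ 2) with a perfect matching. Then SO(G) ≤ β·√((β+1)² + 4) + √((β+1)² + 1) + √5·(β−2) + 2√2, with equality if and only if G ≅ H*(2β,1). -/
attribute [local instance] Classical.propDecidable

open Finset

/-- `G` is the union of the edge-disjoint graphs `H` and the perfect matching `{v, σ v}`. -/
structure MatchingSplit {V : Type*} (G H : SimpleGraph V) (σ : V → V) : Prop where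
  invol : ∀ v, σ (σ v) = v
  adj_iff : ∀ u v, G.Adj u v ↔ H.Adj u v ∨ v = σ u
  not_adj : ∀ v, ¬ H.Adj v (σ v)

theorem SimpleGraph.Subgraph.IsPerfectMatching.exists_matchingSplit {V : Type*}
    {G : SimpleGraph V} {M : G.Subgraph} (hM : M.IsPerfectMatching) :
    ∃ (H : SimpleGraph V) (σ : V → V), MatchingSplit G H σ := by
  rw [SimpleGraph.Subgraph.isPerfectMatching_iff] at hM
  choose σ hσ huniq using hM
  have hadj : ∀ u v, M.Adj u v ↔ v = σ u :=
    fun u v => ⟨fun h => huniq u v h, fun h => h ▸ hσ u⟩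
  refine ⟨G \ M.spanningCoe, σ, fun v => ?_, fun u v => ?_, fun v => ?_⟩
  · exact (huniq (σ v) v (hσ v).symm).symm
  · simp only [SimpleGraph.sdiff_adj, SimpleGraph.Subgraph.spanningCoe_adj]
    have h := hadj u v
    have h' : M.Adj u v → G.Adj u v := fun h => h.adj_sub
    tauto
  · simpa using fun _ => hσ v

namespace MatchingSplit

section Basic

variable {V : Type*} {G H : SimpleGraph V} {σ : V → V}

theorem adj_partner (hs : MatchingSplit G H σ) (v : V) : G.Adj v (σ v) :=
  (hs.adj_iff v (σ v)).2 (Or.inr rfl)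

theorem partner_ne (hs : MatchingSplit G H σ) (v : V) : σ v ≠ v :=
  (hs.adj_partner v).ne'

theorem injective (hs : MatchingSplit G H σ) : Function.Injective σ :=
  Function.Involutive.injective hs.invol

end Basic

variable {V : Type*} [Fintype V] {G H : SimpleGraph V} {σ : V → V}

theorem neighborFinset_eq (hs : MatchingSplit G H σ) (v : V) :
    G.neighborFinset v = insert (σ v) (H.neighborFinset v) := by
  ext w
  simp [hs.adj_iff, or_comm]

theorem degree_eq (hs : MatchingSplit G H σ) (v : V) : G.degree v = H.degree v + 1 := by
  rw [← SimpleGraph.card_neighborFinset_eq_degree, hs.neighborFinset_eq, card_insert_of_notMem,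
    SimpleGraph.card_neighborFinset_eq_degree]
  simpa using hs.not_adj v

theorem two_mul_somborIndex (hs : MatchingSplit G H σ) :
    2 * somborIndex G =
      ∑ u, √((G.degree u : ℝ) ^ 2 + (G.degree (σ u) : ℝ) ^ 2) +
      ∑ u, ∑ v ∈ H.neighborFinset u, √((G.degree u : ℝ) ^ 2 + (G.degree v : ℝ) ^ 2) := by
  rw [somborIndex, mul_div_cancel₀ _ two_ne_zero, ← sum_add_distrib]
  refine sum_congr rfl fun u _ => ?_
  rw [← sum_filter, ← SimpleGraph.neighborFinset_eq_filter, hs.neighborFinset_eq, sum_insert]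
  simpa using hs.not_adj u

theorem card_edgeFinset {β : ℕ} (hs : MatchingSplit G H σ) (hcard : Fintype.card V = 2 * β)
    (huni : G.edgeFinset.card = 2 * β) : H.edgeFinset.card = β := by
  have h1 := G.sum_degrees_eq_twice_card_edges
  have h2 := H.sum_degrees_eq_twice_card_edges
  simp only [hs.degree_eq, sum_add_distrib, sum_const, card_univ, smul_eq_mul] at h1
  omega

theorem degree_pos_of_adj {u v : V} (h : H.Adj u v) : 1 ≤ H.degree u :=
  (H.degree_pos_iff_exists_adj u).2 ⟨v, h⟩

theorem degree_le_card_edgeFinset (v : V) : H.degree v ≤ H.edgeFinset.card := by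
  rw [← H.card_incidenceFinset_eq_degree]
  exact card_le_card (H.incidenceFinset_subset v)

theorem degree_add_degree_le {u v : V} (h : H.Adj u v) :
    H.degree u + H.degree v ≤ H.edgeFinset.card + 1 := by
  rw [← H.card_incidenceFinset_eq_degree, ← H.card_incidenceFinset_eq_degree,
    ← card_union_add_card_inter]
  refine add_le_add (card_le_card (union_subset (H.incidenceFinset_subset u)
    (H.incidenceFinset_subset v))) (card_le_one.2 ?_)
  have key : ∀ e ∈ H.incidenceFinset u ∩ H.incidenceFinset v, e = s(u, v) := by
    intro e he
    rw [mem_inter, SimpleGraph.mem_incidenceFinset, SimpleGraph.mem_incidenceFinset] at he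
    exact (Sym2.mem_and_mem_iff h.ne).1 ⟨he.1.2, he.2.2⟩
  intro a ha b hb
  rw [key a ha, key b hb]

theorem degree_add_degree_partner_pos (hs : MatchingSplit G H σ) (hconn : G.Connected)
    (hcard : 2 < Fintype.card V) (v : V) : 1 ≤ H.degree v + H.degree (σ v) := by
  by_contra! hlt
  have hv : ∀ w, ¬ H.Adj v w := fun w hw => by
    have := degree_pos_of_adj hw
    omega
  have hv' : ∀ w, ¬ H.Adj (σ v) w := fun w hw => by
    have := degree_pos_of_adj hw
    omega
  have hclosed : ∀ x y, G.Reachable x y → x ∈ ({v, σ v} : Finset V) →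
      y ∈ ({v, σ v} : Finset V) := by
    rintro x y ⟨p⟩
    induction p with
    | nil => exact id
    | cons h _ ih =>
      intro hx
      apply ih
      rw [hs.adj_iff] at h
      simp only [mem_insert, mem_singleton] at hx ⊢
      rcases hx with rfl | rfl
      · exact h.elim (fun h => (hv _ h).elim) Or.inr
      · exact h.elim (fun h => (hv' _ h).elim) fun h => Or.inl (h.trans (hs.invol v))
  have huniv : (univ : Finset V) ⊆ {v, σ v} := fun w _ =>
    hclosed v w (hconn.preconnected v w) (by simp)
  have := (card_le_card huniv).trans card_le_two
  rw [card_univ] at this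
  omega

end MatchingSplit

/-- The Sombor index of `HstarGraph β 1`. -/
noncomputable def hstarSombor (b : ℝ) : ℝ :=
  b * √((b + 1) ^ 2 + 4) + √((b + 1) ^ 2 + 1) + √5 * (b - 2) + 2 * √2

theorem sqrt_sq_add_sq_le_sqrt_five_add {x y : ℝ} (hx : 1 ≤ x) (hy : 1 ≤ y) (hxy : 3 ≤ x + y) :
    √(x ^ 2 + y ^ 2) ≤ √5 + (x + y - 3) := by
  rw [Real.sqrt_le_left (by positivity [sub_nonneg.2 hxy])]
  have h5 : 2 ≤ √5 := Real.le_sqrt_of_sq_le (by norm_num)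
  nlinarith [Real.sq_sqrt (show (0 : ℝ) ≤ 5 by norm_num),
    mul_nonneg (sub_nonneg.2 hx) (sub_nonneg.2 hy),
    mul_nonneg (sub_nonneg.2 h5) (sub_nonneg.2 hxy)]

theorem lt_hstarSombor {b : ℝ} (hb : b = 3 ∨ 4 ≤ b) :
    b * √(b ^ 2 + 9) + (√5 + 1) * b < hstarSombor b := by
  have h5 : √5 < 2.2361 := (Real.sqrt_lt' (by norm_num)).2 (by norm_num)
  have h2 : 1.4142 < √2 := Real.lt_sqrt_of_sq_lt (by norm_num)
  unfold hstarSombor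
  rcases hb with rfl | hb
  · have h20 : 4.472 < √((3 + 1) ^ 2 + 4 : ℝ) := Real.lt_sqrt_of_sq_lt (by norm_num)
    have h17 : 4.123 < √((3 + 1) ^ 2 + 1 : ℝ) := Real.lt_sqrt_of_sq_lt (by norm_num)
    have h18 : √(3 ^ 2 + 9 : ℝ) < 4.243 := (Real.sqrt_lt' (by norm_num)).2 (by norm_num)
    generalize √((3 + 1) ^ 2 + 4 : ℝ) = x, √((3 + 1) ^ 2 + 1 : ℝ) = y, √(3 ^ 2 + 9 : ℝ) = z at *
    linarith
  · have h1 : b + 1 ≤ √((b + 1) ^ 2 + 1) := Real.le_sqrt_of_sq_le (by linarith)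
    have h9 : √(b ^ 2 + 9) ≤ b + 1 := Real.sqrt_le_iff.2 ⟨by linarith, by nlinarith⟩
    have hdiff : √(b ^ 2 + 9) + 1 / 3 ≤ √((b + 1) ^ 2 + 4) :=
      Real.le_sqrt_of_sq_le (by nlinarith [Real.sq_sqrt (show 0 ≤ b ^ 2 + 9 by positivity)])
    nlinarith [mul_le_mul_of_nonneg_left hdiff (show 0 ≤ b by linarith)]

theorem sq_add_sq_le_of_add_le {b x y : ℕ} (hx : 2 ≤ x) (hy : 2 ≤ y) (hxb : x ≤ b)
    (hyb : y ≤ b) (hxy : x + y ≤ b + 3) : x ^ 2 + y ^ 2 ≤ b ^ 2 + 9 := by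
  rcases hx.eq_or_lt with rfl | hx
  · nlinarith
  rcases hy.eq_or_lt with rfl | hy
  · nlinarith
  obtain ⟨x, rfl⟩ := Nat.exists_eq_add_of_le (Nat.succ_le_of_lt hx)
  obtain ⟨y, rfl⟩ := Nat.exists_eq_add_of_le (Nat.succ_le_of_lt hy)
  have : x + y + 3 ≤ b := by omega
  nlinarith [Nat.zero_le (x * y)]


namespace MatchingSplit

variable {V : Type*} [Fintype V] {G H : SimpleGraph V} {σ : V → V}

theorem sum_degree {β : ℕ} (hE : H.edgeFinset.card = β) : ∑ v, (H.degree v : ℝ) = 2 * β := by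
  have := H.sum_degrees_eq_twice_card_edges
  rw [hE] at this
  exact_mod_cast this

theorem sum_sum_neighborFinset_le {β : ℕ} (hE : H.edgeFinset.card = β) {f : V → V → ℝ} {C : ℝ}
    (hf : ∀ u v, H.Adj u v → f u v ≤ C) :
    ∑ u, ∑ v ∈ H.neighborFinset u, f u v ≤ 2 * β * C := by
  rw [← sum_degree hE, sum_mul]
  refine sum_le_sum fun u _ => ?_
  have := sum_le_card_nsmul (H.neighborFinset u) (f u) C fun v hv => hf u v (by simpa using hv)
  simpa using this

theorem sum_partner_le {β : ℕ} (hs : MatchingSplit G H σ) (hconn : G.Connected)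
    (hβ : 2 ≤ β) (hcard : Fintype.card V = 2 * β) (hE : H.edgeFinset.card = β) :
    ∑ u, √((G.degree u : ℝ) ^ 2 + (G.degree (σ u) : ℝ) ^ 2) ≤ 2 * ((√5 + 1) * β) := by
  have hσ : ∑ v, (H.degree (σ v) : ℝ) = 2 * β := by
    rw [← sum_degree hE]
    exact Function.Bijective.sum_comp (Function.Involutive.bijective hs.invol)
      fun v => (H.degree v : ℝ)
  calc _ ≤ ∑ u, ((√5 - 1) + ((H.degree u : ℝ) + H.degree (σ u))) := by
        refine sum_le_sum fun u _ => ?_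
        have hpos := hs.degree_add_degree_partner_pos hconn (by omega) u
        have hpos' : (1 : ℝ) ≤ H.degree u + H.degree (σ u) := by exact_mod_cast hpos
        rw [hs.degree_eq, hs.degree_eq]
        push_cast
        refine (sqrt_sq_add_sq_le_sqrt_five_add (by simp) (by simp) (by linarith)).trans_eq ?_
        ring
    _ = _ := by
        rw [sum_add_distrib, sum_add_distrib, sum_degree hE, hσ, sum_const, card_univ, hcard]
        simp only [nsmul_eq_mul]
        push_cast
        ring

theorem somborIndex_lt {β : ℕ} (hs : MatchingSplit G H σ) (hconn : G.Connected)
    (hβ : 2 ≤ β) (hcard : Fintype.card V = 2 * β) (hE : H.edgeFinset.card = β)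
    (hdeg : ∀ v, H.degree v < β) : somborIndex G < hstarSombor β := by
  have hsum := hs.two_mul_somborIndex
  rcases hβ.eq_or_lt with rfl | hβ
  · have hd : ∀ v, (G.degree v : ℝ) ≤ 2 := fun v => by
      rw [hs.degree_eq]
      exact_mod_cast hdeg v
    have h8 : ∀ u v, √((G.degree u : ℝ) ^ 2 + (G.degree v : ℝ) ^ 2) ≤ 2.83 := fun u v => by
      rw [Real.sqrt_le_left (by norm_num)]
      have hu := pow_le_pow_left₀ (Nat.cast_nonneg _) (hd u) 2
      have hv := pow_le_pow_left₀ (Nat.cast_nonneg _) (hd v) 2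
      norm_num at hu hv ⊢
      linarith
    have h1 := sum_sum_neighborFinset_le hE fun u v _ => h8 u v
    have h2 := sum_le_card_nsmul univ _ _ fun u _ => h8 u (σ u)
    rw [card_univ, hcard] at h2
    norm_num at h1 h2
    have h13 : 3.6 < √((2 + 1) ^ 2 + 4 : ℝ) := Real.lt_sqrt_of_sq_lt (by norm_num)
    have h10 : 3.1 < √((2 + 1) ^ 2 + 1 : ℝ) := Real.lt_sqrt_of_sq_lt (by norm_num)
    have h2' : 1.41 < √2 := Real.lt_sqrt_of_sq_lt (by norm_num)
    simp only [hstarSombor, Nat.cast_ofNat]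
    norm_num at h13 h10 ⊢
    linarith
  · have h1 := sum_sum_neighborFinset_le hE
      (f := fun u v => √((G.degree u : ℝ) ^ 2 + (G.degree v : ℝ) ^ 2)) (C := √(β ^ 2 + 9))
      fun u v h => by
        refine Real.sqrt_le_sqrt ?_
        have hu := degree_pos_of_adj h
        have hv := degree_pos_of_adj h.symm
        have huv := degree_add_degree_le h
        have hub := hdeg u
        have hvb := hdeg v
        rw [hs.degree_eq, hs.degree_eq]
        exact_mod_cast sq_add_sq_le_of_add_le (by omega) (by omega) hub hvb (by omega)
    have h2 := hs.sum_partner_le hconn hβ.le hcard hE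
    have h3 : (β : ℝ) = 3 ∨ (4 : ℝ) ≤ β := by
      rcases Nat.lt_or_ge 3 β with h | h
      · exact Or.inr (by exact_mod_cast h)
      · exact Or.inl (by exact_mod_cast le_antisymm h hβ)
    linarith [lt_hstarSombor h3]

end MatchingSplit

namespace MatchingSplit

variable {V : Type*} [Fintype V] {G H : SimpleGraph V} {σ : V → V} {β : ℕ} {c : V}

theorem eq_or_eq_of_adj (hE : H.edgeFinset.card = β) (hc : H.degree c = β) {u v : V}
    (h : H.Adj u v) : u = c ∨ v = c := by
  have heq : H.incidenceFinset c = H.edgeFinset :=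
    eq_of_subset_of_card_le (H.incidenceFinset_subset c)
      (by rw [H.card_incidenceFinset_eq_degree, hE, hc])
  have hmem : s(u, v) ∈ H.incidenceFinset c := by
    rw [heq, SimpleGraph.mem_edgeFinset]
    exact h
  rw [SimpleGraph.mem_incidenceFinset] at hmem
  simpa [eq_comm] using hmem.2

theorem degree_eq_one_of_center_adj (hE : H.edgeFinset.card = β) (hc : H.degree c = β) {v : V}
    (h : H.Adj c v) : H.degree v = 1 := by
  rw [H.degree_eq_one_iff_existsUnique_adj]
  exact ⟨c, h.symm, fun w hw => (eq_or_eq_of_adj hE hc hw).resolve_left h.ne'⟩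

theorem degree_eq_zero_of_not_center_adj (hE : H.edgeFinset.card = β) (hc : H.degree c = β)
    {v : V} (hv : v ≠ c) (h : ¬ H.Adj c v) : H.degree v = 0 := by
  by_contra hne
  obtain ⟨w, hw⟩ := (H.degree_pos_iff_exists_adj v).1 (Nat.pos_of_ne_zero hne)
  obtain rfl := (eq_or_eq_of_adj hE hc hw).resolve_left hv
  exact h hw.symm

/-- The vertices that are neither the center `c`, nor its partner, nor adjacent to `c` in `H`. -/
noncomputable def remote (H : SimpleGraph V) (σ : V → V) (c : V) : Finset V :=
  {v | v ≠ c ∧ v ≠ σ c ∧ ¬ H.Adj c v}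

theorem mem_remote {v : V} : v ∈ remote H σ c ↔ v ≠ c ∧ v ≠ σ c ∧ ¬ H.Adj c v := by
  simp [remote]

theorem center_adj_partner_of_mem_remote (hs : MatchingSplit G H σ) (hconn : G.Connected)
    (hcard : 2 < Fintype.card V) (hE : H.edgeFinset.card = β) (hc : H.degree c = β) {v : V}
    (hv : v ∈ remote H σ c) : H.Adj c (σ v) := by
  rw [mem_remote] at hv
  by_contra h
  have hne : σ v ≠ c := fun h => hv.2.1 (by rw [← h, hs.invol])
  have := hs.degree_add_degree_partner_pos hconn hcard v
  rw [degree_eq_zero_of_not_center_adj hE hc hv.1 hv.2.2,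
    degree_eq_zero_of_not_center_adj hE hc hne h] at this
  omega

/-- The vertex set splits into the center and its partner, the neighbours of the center, and
the remote vertices. -/
theorem sum_eq_of_center (hs : MatchingSplit G H σ) (F : V → ℝ) :
    ∑ v, F v = F c + F (σ c) + ∑ v ∈ H.neighborFinset c, F v + ∑ v ∈ remote H σ c, F v := by
  have huniv : (univ : Finset V) = ({c, σ c} ∪ H.neighborFinset c) ∪ remote H σ c := by
    ext v
    simp only [mem_univ, mem_union, mem_insert, mem_singleton, SimpleGraph.mem_neighborFinset,
      mem_remote, true_iff]
    tauto
  rw [huniv, sum_union, sum_union, sum_pair (hs.partner_ne c).symm]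
  · rw [disjoint_left]
    intro v hv
    simp only [mem_insert, mem_singleton] at hv
    rcases hv with rfl | rfl
    · simp
    · simpa using hs.not_adj c
  · rw [disjoint_left]
    intro v hv
    simp only [mem_union, mem_insert, mem_singleton, SimpleGraph.mem_neighborFinset] at hv
    rw [mem_remote]
    tauto

theorem card_remote (hs : MatchingSplit G H σ) (hcard : Fintype.card V = 2 * β)
    (hc : H.degree c = β) : (remote H σ c).card + 2 = β := by
  have := hs.sum_eq_of_center (c := c) fun _ => 1
  simp only [sum_const, card_univ, hcard, nsmul_eq_mul, mul_one,
    SimpleGraph.card_neighborFinset_eq_degree, hc] at this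
  have h : ((2 * β : ℕ) : ℝ) = ((2 + β + (remote H σ c).card : ℕ) : ℝ) := by
    rw [this]
    push_cast
    ring
  have := Nat.cast_injective h
  omega

/-- Exactly one matching edge has both of its ends adjacent to the center; every other neighbour
of the center is the partner of a remote vertex. -/
theorem exists_triangle (hs : MatchingSplit G H σ) (hconn : G.Connected) (hβ : 2 ≤ β)
    (hcard : Fintype.card V = 2 * β) (hE : H.edgeFinset.card = β) (hc : H.degree c = β) :
    ∃ a, H.Adj c a ∧ H.Adj c (σ a) ∧
      H.neighborFinset c = {a, σ a} ∪ (remote H σ c).image σ ∧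
      Disjoint {a, σ a} ((remote H σ c).image σ) := by
  have hadj : ∀ v ∈ remote H σ c, H.Adj c (σ v) := fun v =>
    hs.center_adj_partner_of_mem_remote hconn (by omega) hE hc
  have hsub : (remote H σ c).image σ ⊆ H.neighborFinset c := by
    intro w hw
    obtain ⟨v, hv, rfl⟩ := mem_image.1 hw
    simpa using hadj v hv
  have hD : (H.neighborFinset c \ (remote H σ c).image σ).card = 2 := by
    rw [card_sdiff_of_subset hsub, card_image_of_injective _ hs.injective,
      SimpleGraph.card_neighborFinset_eq_degree, hc]
    have := hs.card_remote hcard hc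
    omega
  have hσD : ∀ v ∈ H.neighborFinset c \ (remote H σ c).image σ,
      σ v ∈ H.neighborFinset c \ (remote H σ c).image σ := by
    intro v hv
    simp only [mem_sdiff, SimpleGraph.mem_neighborFinset] at hv ⊢
    obtain ⟨hv, hvB⟩ := hv
    constructor
    · by_contra hn
      refine hvB (mem_image.2 ⟨σ v, mem_remote.2 ⟨?_, ?_, hn⟩, hs.invol v⟩)
      · intro h
        exact hs.not_adj c (by rwa [← h, hs.invol, h])
      · exact fun h => hv.ne (hs.injective h).symm
    · intro hm
      obtain ⟨w, hw, hwv⟩ := mem_image.1 hm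
      obtain rfl := hs.injective hwv
      exact (mem_remote.1 hw).2.2 hv
  obtain ⟨a, ha⟩ := card_pos.1 (hD ▸ two_pos)
  have hpair : {a, σ a} = H.neighborFinset c \ (remote H σ c).image σ := by
    refine eq_of_subset_of_card_le ?_ ?_
    · intro v hv
      simp only [mem_insert, mem_singleton] at hv
      rcases hv with rfl | rfl
      · exact ha
      · exact hσD a ha
    · rw [hD, card_pair (hs.partner_ne a).symm]
  refine ⟨a, ?_, ?_, ?_, ?_⟩
  · simpa using (mem_sdiff.1 ha).1
  · simpa using (mem_sdiff.1 (hσD a ha)).1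
  · rw [hpair, sdiff_union_of_subset hsub]
  · rw [hpair]
    exact sdiff_disjoint

theorem somborIndex_eq (hs : MatchingSplit G H σ) (hconn : G.Connected) (hβ : 2 ≤ β)
    (hcard : Fintype.card V = 2 * β) (hE : H.edgeFinset.card = β) (hc : H.degree c = β) :
    somborIndex G = hstarSombor β := by
  have h2 : 2 < Fintype.card V := by omega
  have hsum := hs.two_mul_somborIndex
  have hdc : (G.degree c : ℝ) = β + 1 := by rw [hs.degree_eq, hc]; push_cast; rfl
  have hdN : ∀ v, H.Adj c v → (G.degree v : ℝ) = 2 := fun v hv => by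
    rw [hs.degree_eq, degree_eq_one_of_center_adj hE hc hv]
    norm_num
  have hd0 : ∀ v, v ≠ c → ¬ H.Adj c v → (G.degree v : ℝ) = 1 := fun v hv h => by
    rw [hs.degree_eq, degree_eq_zero_of_not_center_adj hE hc hv h]
    norm_num
  have hinv : ∀ v, G.degree (σ (σ v)) = G.degree v := fun v => by rw [hs.invol]
  have hdσc := hd0 (σ c) (hs.partner_ne c) (hs.not_adj c)
  have hB := hs.card_remote hcard hc
  have hB' : ((remote H σ c).card : ℝ) = β - 2 := by
    rw [← hB]
    push_cast
    ring
  have hoff : ∑ u, ∑ v ∈ H.neighborFinset u,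
      √((G.degree u : ℝ) ^ 2 + (G.degree v : ℝ) ^ 2) = 2 * β * √((β + 1 : ℝ) ^ 2 + 4) := by
    rw [← sum_degree hE, sum_mul]
    refine sum_congr rfl fun u _ => ?_
    rw [← H.card_neighborFinset_eq_degree, ← nsmul_eq_mul]
    refine sum_eq_card_nsmul fun v hv => ?_
    rw [SimpleGraph.mem_neighborFinset] at hv
    rcases eq_or_eq_of_adj hE hc hv with rfl | rfl
    · rw [hdc, hdN v hv]
      norm_num
    · rw [hdc, hdN u hv.symm, add_comm]
      norm_num
  obtain ⟨a, ha, ha', hN, hdisj⟩ := hs.exists_triangle hconn hβ hcard hE hc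
  have h5 : ∀ v ∈ remote H σ c, √((G.degree v : ℝ) ^ 2 + (G.degree (σ v) : ℝ) ^ 2) = √5 := by
    intro v hv
    rw [hdN _ (hs.center_adj_partner_of_mem_remote hconn h2 hE hc hv)]
    rw [mem_remote] at hv
    rw [hd0 v hv.1 hv.2.2]
    norm_num
  have h5' : ∀ v ∈ remote H σ c,
      √((G.degree (σ v) : ℝ) ^ 2 + (G.degree (σ (σ v)) : ℝ) ^ 2) = √5 := by
    intro v hv
    rw [hs.invol, add_comm, h5 v hv]
  have h8 : √((2 : ℝ) ^ 2 + 2 ^ 2) = 2 * √2 := by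
    rw [show (2 : ℝ) ^ 2 + 2 ^ 2 = 2 ^ 2 * 2 by norm_num, Real.sqrt_mul (by norm_num),
      Real.sqrt_sq (by norm_num)]
  rw [hs.sum_eq_of_center (c := c), hN, sum_union hdisj, sum_pair (hs.partner_ne a).symm,
    sum_image hs.injective.injOn, sum_congr rfl h5, sum_congr rfl h5', hoff] at hsum
  simp only [hinv, hdc, hdσc, hdN _ ha, hdN _ ha', h8, sum_const, nsmul_eq_mul, hB',
    one_pow] at hsum
  rw [add_comm (1 : ℝ)] at hsum
  unfold hstarSombor
  linarith

end MatchingSplit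

theorem hstarGraph_one_adj {β : ℕ} (i j : Fin (2 * β)) :
    (HstarGraph β 1).Adj i j ↔ i ≠ j ∧
      (((i.val = 0 ∧ 1 ≤ j.val ∧ j.val ≤ β + 1) ∨ (i.val = 1 ∧ j.val = 2) ∨
        (3 ≤ i.val ∧ i.val ≤ β ∧ j.val + 1 = i.val + β)) ∨
      ((j.val = 0 ∧ 1 ≤ i.val ∧ i.val ≤ β + 1) ∨ (j.val = 1 ∧ i.val = 2) ∨
        (3 ≤ j.val ∧ j.val ≤ β ∧ i.val + 1 = j.val + β))) := by
  have htri : ∀ u v : ℕ, (∃ k, k < 1 ∧ u = 2 * k + 1 ∧ v = 2 * k + 2) ↔ u = 1 ∧ v = 2 :=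
    fun u v => ⟨by rintro ⟨k, hk⟩; omega, fun h => ⟨0, by omega⟩⟩
  have hpend : ∀ u v : ℕ, (∃ j, 1 ≤ j ∧ j ≤ β - 1 - 1 ∧ u = 2 * 1 + j ∧ v = β + 1 + j) ↔
      3 ≤ u ∧ u ≤ β ∧ v + 1 = u + β :=
    fun u v => ⟨by rintro ⟨k, hk⟩; omega, fun h => ⟨u - 2, by omega⟩⟩
  simp only [HstarGraph, SimpleGraph.fromRel_adj, htri, hpend]

theorem le_degree_hstarGraph_one {β : ℕ} (hβ : 2 ≤ β) :
    β + 1 ≤ (HstarGraph β 1).degree ⟨0, by omega⟩ := by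
  have hinj : Function.Injective fun k : Fin (β + 1) => (⟨k + 1, by omega⟩ : Fin (2 * β)) := by
    intro k l h
    simpa [Fin.ext_iff] using h
  rw [← SimpleGraph.card_neighborFinset_eq_degree]
  calc β + 1 = (univ.image fun k : Fin (β + 1) => (⟨k + 1, by omega⟩ : Fin (2 * β))).card := by
        rw [card_image_of_injective _ hinj, card_univ, Fintype.card_fin]
    _ ≤ _ := by
        refine card_le_card fun v hv => ?_
        obtain ⟨k, -, rfl⟩ := mem_image.1 hv
        rw [SimpleGraph.mem_neighborFinset, hstarGraph_one_adj]
        exact ⟨fun h => Nat.succ_ne_zero _ (Fin.ext_iff.1 h).symm,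
          Or.inl (Or.inl ⟨rfl, Nat.le_add_left 1 k, k.2⟩)⟩

/-- The labelling of the vertices of `HstarGraph β 1` by the center `c`, its partner, the
triangle `c`, `a`, `σ a`, the remote vertices `e k` and their partners. -/
def hstarLabel {V : Type*} (β : ℕ) (σ : V → V) (c a : V) (e : ℕ → V) (i : ℕ) : V :=
  if i = 0 then c else if i = 1 then a else if i = 2 then σ a else
  if i ≤ β then σ (e (i - 3)) else if i = β + 1 then σ c else e (i - (β + 2))

/-- The perfect matching of `HstarGraph β 1`. -/
def hstarPartner (β i : ℕ) : ℕ :=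
  if i = 0 then β + 1 else if i = 1 then 2 else if i = 2 then 1 else
  if i ≤ β then i + β - 1 else if i = β + 1 then 0 else i + 1 - β

theorem hstarPartner_lt {β i : ℕ} (hβ : 2 ≤ β) (hi : i < 2 * β) : hstarPartner β i < 2 * β := by
  unfold hstarPartner
  split_ifs <;> omega

namespace MatchingSplit

theorem partner_hstarLabel {V : Type*} {G H : SimpleGraph V} {σ : V → V} {β : ℕ} {c : V}
    (hs : MatchingSplit G H σ) (hβ : 2 ≤ β) (a : V) (e : ℕ → V) {i : ℕ}
    (hi : i < 2 * β) :
    σ (hstarLabel β σ c a e i) = hstarLabel β σ c a e (hstarPartner β i) := by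
  unfold hstarPartner
  split_ifs with h0 h1 h2 h3 h4
  · subst h0
    have : β ≠ 0 ∧ β ≠ 1 := by omega
    simp [hstarLabel, this]
  · subst h1
    simp [hstarLabel]
  · subst h2
    simp [hstarLabel, hs.invol]
  · have h : i + β - 1 - (β + 2) = i - 3 := by omega
    have h' : ¬ i + β - 1 = 0 ∧ ¬ i + β - 1 = 1 ∧ ¬ i + β - 1 = 2 ∧ ¬ i + β - 1 ≤ β ∧
      ¬ i + β - 1 = β + 1 := by omega
    simp only [hstarLabel, h0, h1, h2, h3, h, h', if_true, if_false, hs.invol]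
  · subst h4
    have : β ≠ 0 ∧ β ≠ 1 := by omega
    simp [hstarLabel, this, hs.invol]
  · have h : i + 1 - β - 3 = i - (β + 2) := by omega
    have h' : ¬ i + 1 - β = 0 ∧ ¬ i + 1 - β = 1 ∧ ¬ i + 1 - β = 2 ∧ i + 1 - β ≤ β := by omega
    simp only [hstarLabel, h0, h1, h2, h3, h4, h, h', if_true, if_false]

variable {V : Type*} [Fintype V] {G H : SimpleGraph V} {σ : V → V} {β : ℕ} {c : V}

theorem nonempty_iso (hs : MatchingSplit G H σ) (hconn : G.Connected) (hβ : 2 ≤ β)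
    (hcard : Fintype.card V = 2 * β) (hE : H.edgeFinset.card = β) (hc : H.degree c = β) :
    Nonempty (G ≃g HstarGraph β 1) := by
  have h2 : 2 < Fintype.card V := by omega
  obtain ⟨a, ha, ha', hN, -⟩ := hs.exists_triangle hconn hβ hcard hE hc
  have hB : (remote H σ c).card = β - 2 := by
    have := hs.card_remote hcard hc
    omega
  let ε := (remote H σ c).equivFinOfCardEq hB
  let e : ℕ → V := fun k => if h : k < β - 2 then ε.symm ⟨k, h⟩ else c
  have he : ∀ k, k < β - 2 → e k ∈ remote H σ c := fun k hk => by
    simp only [e, hk, dif_pos]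
    exact (ε.symm _).2
  have he' : ∀ v ∈ remote H σ c, ∃ k, k < β - 2 ∧ e k = v := fun v hv =>
    ⟨ε ⟨v, hv⟩, (ε ⟨v, hv⟩).2, by simp [e]⟩
  let φ : ℕ → V := hstarLabel β σ c a e
  have hφσ : ∀ i, i < 2 * β → σ (φ i) = φ (hstarPartner β i) := fun i hi =>
    hs.partner_hstarLabel hβ a e hi
  have hφ0 : φ 0 = c := by simp [φ, hstarLabel]
  have hφ1 : φ 1 = a := by simp [φ, hstarLabel]
  have hφ2 : φ 2 = σ a := by simp [φ, hstarLabel]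
  have hφr : ∀ k, k < β - 2 → φ (k + (β + 2)) = e k := fun k hk => by
    have h : ¬ k + (β + 2) = 0 ∧ ¬ k + (β + 2) = 1 ∧ ¬ k + (β + 2) = 2 ∧ ¬ k + (β + 2) ≤ β ∧
      ¬ k + (β + 2) = β + 1 := by omega
    simp only [φ, hstarLabel, h, if_false, Nat.add_sub_cancel]
  have hφs : ∀ k, k < β - 2 → φ (k + 3) = σ (e k) := fun k hk => by
    have h : ¬ k + 3 = 0 ∧ ¬ k + 3 = 1 ∧ ¬ k + 3 = 2 ∧ k + 3 ≤ β := by omega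
    simp only [φ, hstarLabel, h, if_false, if_true, Nat.add_sub_cancel]
  have hφc : φ (β + 1) = σ c := by
    rw [← hφ0, hφσ 0 (by omega)]
    rfl
  have hsurj : ∀ v, ∃ i, i < 2 * β ∧ φ i = v := by
    intro v
    by_cases hvc : v = c
    · exact ⟨0, by omega, hvc ▸ hφ0⟩
    by_cases hvc' : v = σ c
    · exact ⟨β + 1, by omega, hvc' ▸ hφc⟩
    by_cases hv : H.Adj c v
    · rw [← SimpleGraph.mem_neighborFinset, hN] at hv
      simp only [mem_union, mem_insert, mem_singleton, mem_image] at hv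
      rcases hv with (rfl | rfl) | ⟨w, hw, rfl⟩
      · exact ⟨1, by omega, hφ1⟩
      · exact ⟨2, by omega, hφ2⟩
      · obtain ⟨k, hk, rfl⟩ := he' w hw
        exact ⟨k + 3, by omega, hφs k hk⟩
    · obtain ⟨k, hk, rfl⟩ := he' v (mem_remote.2 ⟨hvc, hvc', hv⟩)
      exact ⟨k + (β + 2), by omega, hφr k hk⟩
  have hbij : Function.Bijective fun i : Fin (2 * β) => φ i := by
    rw [Fintype.bijective_iff_surjective_and_card]
    refine ⟨fun v => ?_, by rw [Fintype.card_fin, hcard]⟩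
    obtain ⟨i, hi, h⟩ := hsurj v
    exact ⟨⟨i, hi⟩, h⟩
  have hinj : ∀ i j, i < 2 * β → j < 2 * β → (φ i = φ j ↔ i = j) := fun i j hi hj =>
    ⟨fun h => Fin.ext_iff.1 (hbij.1 (a₁ := ⟨i, hi⟩) (a₂ := ⟨j, hj⟩) h), fun h => h ▸ rfl⟩
  have hφN : ∀ i, i < 2 * β → (H.Adj c (φ i) ↔ 1 ≤ i ∧ i ≤ β) := by
    intro i hi
    rcases (by omega : i = 0 ∨ i = 1 ∨ i = 2 ∨ (3 ≤ i ∧ i ≤ β) ∨ i = β + 1 ∨ β + 2 ≤ i) with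
      rfl | rfl | rfl | ⟨h, hk⟩ | rfl | h
    · simp [hφ0]
    · simp only [hφ1, ha, true_iff]
      omega
    · simp only [hφ2, ha', true_iff]
      omega
    · obtain ⟨k, rfl⟩ := Nat.exists_eq_add_of_le' h
      have hk : k < β - 2 := by omega
      simp only [hφs k hk, true_iff,
        hs.center_adj_partner_of_mem_remote hconn h2 hE hc (he k hk)]
      omega
    · simp only [hφc, hs.not_adj, false_iff]
      omega
    · obtain ⟨k, rfl⟩ := Nat.exists_eq_add_of_le' h
      have hk : k < β - 2 := by omega
      simp only [hφr k hk, (mem_remote.1 (he k hk)).2.2, false_iff]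
      omega
  have hHadj : ∀ u v, H.Adj u v ↔ (u = c ∧ H.Adj c v) ∨ (v = c ∧ H.Adj c u) := by
    refine fun u v => ⟨fun h => ?_, ?_⟩
    · rcases eq_or_eq_of_adj hE hc h with rfl | rfl
      · exact Or.inl ⟨rfl, h⟩
      · exact Or.inr ⟨rfl, h.symm⟩
    · rintro (⟨rfl, h⟩ | ⟨rfl, h⟩)
      · exact h
      · exact h.symm
  refine ⟨SimpleGraph.Iso.symm ⟨Equiv.ofBijective _ hbij, ?_⟩⟩
  intro i j
  have hci : ∀ i, i < 2 * β → (φ i = c ↔ i = 0) := fun i hi => by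
    rw [← hφ0, hinj i 0 hi (by omega)]
  rw [Equiv.ofBijective_apply, Equiv.ofBijective_apply, hs.adj_iff, hHadj, hφσ i i.2,
    hinj _ _ j.2 (hstarPartner_lt hβ i.2), hci i i.2, hci j j.2, hφN i i.2, hφN j j.2,
    hstarGraph_one_adj, ne_eq, Fin.ext_iff]
  have hi := i.2
  have hj := j.2
  unfold hstarPartner
  split_ifs <;> omega

end MatchingSplit

theorem unicyclic_pm_sombor_le {V : Type*} [Fintype V] (G : SimpleGraph V) (β : ℕ)
    (hβ : 2 ≤ β) (hcard : Fintype.card V = 2 * β) (hconn : G.Connected)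
    (huni : G.edgeFinset.card = 2 * β)
    (hpm : ∃ M : G.Subgraph, M.IsPerfectMatching) :
    somborIndex G ≤ (β : ℝ) * Real.sqrt (((β : ℝ) + 1)^2 + 4) +
        Real.sqrt (((β : ℝ) + 1)^2 + 1) + Real.sqrt 5 * ((β : ℝ) - 2) + 2 * Real.sqrt 2 ∧
    (somborIndex G = (β : ℝ) * Real.sqrt (((β : ℝ) + 1)^2 + 4) +
        Real.sqrt (((β : ℝ) + 1)^2 + 1) + Real.sqrt 5 * ((β : ℝ) - 2) + 2 * Real.sqrt 2 ↔
      Nonempty (G ≃g HstarGraph β 1)) := by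
  obtain ⟨M, hM⟩ := hpm
  obtain ⟨H, σ, hs⟩ := hM.exists_matchingSplit
  have hE := hs.card_edgeFinset hcard huni
  change somborIndex G ≤ hstarSombor β ∧ (somborIndex G = hstarSombor β ↔ _)
  by_cases h : ∀ v, H.degree v < β
  · have hlt := hs.somborIndex_lt hconn hβ hcard hE h
    refine ⟨hlt.le, fun heq => (hlt.ne heq).elim, ?_⟩
    rintro ⟨f⟩
    have h1 := le_degree_hstarGraph_one hβ
    rw [← f.symm.degree_eq, hs.degree_eq] at h1
    have h2 := h (f.symm ⟨0, by omega⟩)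
    omega
  · push Not at h
    obtain ⟨c, hc⟩ := h
    have hc := le_antisymm (hE ▸ MatchingSplit.degree_le_card_edgeFinset c) hc
    have heq := hs.somborIndex_eq hconn hβ hcard hE hc
    exact ⟨heq.le, fun _ => hs.nonempty_iso hconn hβ hcard hE hc, fun _ => heq⟩
end

section
/- Let G be a cactus with 2β vertices (β ≥ 2), t cycles, and a perfect matching. Then SO(G) ≤ (β+t−1)·√((β+t)² + 4) + √((β+t)² + 1) + √5·(β−t−1) + 2√2·t, with equality if and only if G ≅ H*(2β,t). -/
attribute [local instance] Classical.propDecidable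

namespace SomborCactus

open SimpleGraph Finset

section Matching

variable {V : Type*}

/-- The graph obtained from `G` by deleting the edges `v — m v`. -/
def offMatching (G : SimpleGraph V) (m : V → V) : SimpleGraph V :=
  G \ SimpleGraph.fromRel (fun u v => v = m u)

/-- The involution exchanging the ends of every edge of a perfect matching. -/
structure IsMatchingMap (G : SimpleGraph V) (m : V → V) : Prop where
  adj : ∀ v, G.Adj v (m v)
  invol : ∀ v, m (m v) = v

lemma exists_isMatchingMap {G : SimpleGraph V} {M : G.Subgraph} (hM : M.IsPerfectMatching) :
    ∃ m : V → V, IsMatchingMap G m := by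
  have h : ∀ v, ∃! w, M.Adj v w := fun v => hM.1 (hM.2 v)
  choose m hm hu using h
  exact ⟨m, fun v => (hm v).adj_sub, fun v => (hu (m v) v (hm v).symm).symm⟩

lemma mem_of_connected {G : SimpleGraph V} (hG : G.Connected) {s : Set V} {a : V} (ha : a ∈ s)
    (hs : ∀ u v, G.Adj u v → u ∈ s → v ∈ s) (b : V) : b ∈ s := by
  obtain ⟨p⟩ := hG.preconnected a b
  induction p with
  | nil => exact ha
  | cons h _ ih => exact ih (hs _ _ h ha)

namespace IsMatchingMap

variable {G : SimpleGraph V} {m : V → V}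

lemma ne (h : IsMatchingMap G m) (v : V) : m v ≠ v := (h.adj v).ne'

lemma eq_comm_iff (h : IsMatchingMap G m) (u v : V) : u = m v ↔ v = m u :=
  ⟨fun e => by rw [e, h.invol], fun e => by rw [e, h.invol]⟩

lemma offMatching_adj (h : IsMatchingMap G m) (u v : V) :
    (offMatching G m).Adj u v ↔ G.Adj u v ∧ v ≠ m u := by
  rw [offMatching, SimpleGraph.sdiff_adj, SimpleGraph.fromRel_adj]
  have := h.eq_comm_iff u v
  constructor
  · rintro ⟨h1, h2⟩
    exact ⟨h1, fun e => h2 ⟨h1.ne, Or.inl e⟩⟩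
  · rintro ⟨h1, h2⟩
    refine ⟨h1, fun e => ?_⟩
    rcases e.2 with e | e
    · exact h2 e
    · exact h2 (this.1 e)

lemma adj_iff (h : IsMatchingMap G m) (u v : V) :
    G.Adj u v ↔ (offMatching G m).Adj u v ∨ v = m u := by
  rw [h.offMatching_adj]
  constructor
  · intro a
    by_cases e : v = m u
    · exact Or.inr e
    · exact Or.inl ⟨a, e⟩
  · rintro (a | rfl)
    · exact a.1
    · exact h.adj u

variable [Fintype V]

lemma degree_eq (h : IsMatchingMap G m) (v : V) :
    G.degree v = (offMatching G m).degree v + 1 := by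
  have e : G.neighborFinset v = insert (m v) ((offMatching G m).neighborFinset v) := by
    ext w
    simp only [mem_neighborFinset, mem_insert]
    rw [h.adj_iff, or_comm]
  rw [← card_neighborFinset_eq_degree, e, card_insert_of_notMem,
    card_neighborFinset_eq_degree]
  simp [h.offMatching_adj]

lemma two_mul_card_edgeFinset (h : IsMatchingMap G m) :
    2 * G.edgeFinset.card = 2 * (offMatching G m).edgeFinset.card + Fintype.card V := by
  rw [← G.sum_degrees_eq_twice_card_edges, ← (offMatching G m).sum_degrees_eq_twice_card_edges]
  simp [h.degree_eq, sum_add_distrib]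

lemma sum_comp (h : IsMatchingMap G m) {A : Type*} [AddCommMonoid A] (g : V → A) :
    ∑ v, g (m v) = ∑ v, g v :=
  Equiv.sum_comp (Function.Involutive.toPerm m h.invol) g

lemma somborIndex_eq (h : IsMatchingMap G m) :
    somborIndex G =
      (∑ v, Real.sqrt ((G.degree v : ℝ)^2 + (G.degree (m v) : ℝ)^2)) / 2 +
      (∑ u, ∑ v, if (offMatching G m).Adj u v then
        Real.sqrt ((G.degree u : ℝ)^2 + (G.degree v : ℝ)^2) else 0) / 2 := by
  rw [somborIndex, ← add_div, ← sum_add_distrib]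
  congr 1
  refine sum_congr rfl fun u _ => ?_
  have : Real.sqrt ((G.degree u : ℝ)^2 + (G.degree (m u) : ℝ)^2) =
      ∑ v, if v = m u then Real.sqrt ((G.degree u : ℝ)^2 + (G.degree v : ℝ)^2) else 0 := by
    simp
  rw [this, ← sum_add_distrib]
  refine sum_congr rfl fun v _ => ?_
  by_cases e : v = m u
  · subst e
    simp [h.offMatching_adj, h.adj]
  · simp [h.offMatching_adj, e]

end IsMatchingMap

variable [Fintype V]

lemma sum_sum_adj_const (N : SimpleGraph V) (a : ℝ) :
    (∑ u, ∑ v, if N.Adj u v then a else 0) = 2 * N.edgeFinset.card * a := by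
  have h : ∀ u, (∑ v, if N.Adj u v then a else 0) = N.degree u * a := by
    intro u
    rw [← sum_filter, sum_const, nsmul_eq_mul, ← card_neighborFinset_eq_degree]
    congr 3
    ext w
    simp
  simp_rw [h]
  rw [← sum_mul]
  have := N.sum_degrees_eq_twice_card_edges
  rw [← Nat.cast_sum, this]
  push_cast
  ring

lemma degree_le_card_edgeFinset (N : SimpleGraph V) (v : V) :
    N.degree v ≤ N.edgeFinset.card := by
  rw [← card_incidenceFinset_eq_degree]
  exact card_le_card (N.incidenceFinset_subset v)

lemma degree_add_degree_le (N : SimpleGraph V) {u v : V} (huv : u ≠ v) :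
    N.degree u + N.degree v ≤ N.edgeFinset.card + 1 := by
  rw [← card_incidenceFinset_eq_degree, ← card_incidenceFinset_eq_degree,
    ← card_union_add_card_inter]
  refine add_le_add (card_le_card (union_subset (N.incidenceFinset_subset u)
    (N.incidenceFinset_subset v))) ?_
  rw [card_le_one]
  intro a ha b hb
  simp only [mem_inter, mem_incidenceFinset, incidenceSet, Set.mem_ofPred_eq] at ha hb
  rw [(Sym2.mem_and_mem_iff huv).1 ⟨ha.1.2, ha.2.2⟩, (Sym2.mem_and_mem_iff huv).1 ⟨hb.1.2, hb.2.2⟩]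

/-- If the degree of `c` is the number of edges, then every edge is incident to `c`. -/
lemma eq_or_eq_of_degree_eq (N : SimpleGraph V) {c : V} (hc : N.degree c = N.edgeFinset.card)
    {u v : V} (huv : N.Adj u v) : u = c ∨ v = c := by
  have e : N.incidenceFinset c = N.edgeFinset :=
    eq_of_subset_of_card_le (N.incidenceFinset_subset c)
      (by rw [card_incidenceFinset_eq_degree, hc])
  have : s(u, v) ∈ N.incidenceFinset c := by rw [e]; simpa using huv
  simp only [mem_incidenceFinset, incidenceSet, Set.mem_ofPred_eq, Sym2.mem_iff] at this
  rcases this.2 with h | h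
  · exact Or.inl h.symm
  · exact Or.inr h.symm

lemma IsMatchingMap.exists_offMatching_adj {G : SimpleGraph V} {m : V → V}
    (h : IsMatchingMap G m) (hG : G.Connected) (hcard : 2 < Fintype.card V) (v : V) :
    ∃ w, (offMatching G m).Adj v w ∨ (offMatching G m).Adj (m v) w := by
  by_contra! hno
  have key : ∀ b, b ∈ ({v, m v} : Set V) := by
    refine mem_of_connected hG (a := v) (by simp) fun x y hxy hx => ?_
    rcases (h.adj_iff x y).1 hxy with a | a
    · rcases hx with rfl | hx
      · exact absurd a (hno y).1
      · rw [Set.mem_singleton_iff] at hx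
        subst hx
        exact absurd a (hno y).2
    · rcases hx with rfl | hx
      · simp [a]
      · rw [Set.mem_singleton_iff] at hx
        rw [a, hx, h.invol]
        simp
  have : (univ : Finset V) ⊆ {v, m v} := fun b _ => by simpa using key b
  have := card_le_card this
  rw [card_univ] at this
  have := card_le_two (a := v) (b := m v)
  omega

lemma IsMatchingMap.three_le_degree_add {G : SimpleGraph V} {m : V → V}
    (h : IsMatchingMap G m) (hG : G.Connected) (hcard : 2 < Fintype.card V) (v : V) :
    3 ≤ G.degree v + G.degree (m v) := by
  obtain ⟨w, hw⟩ := h.exists_offMatching_adj hG hcard v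
  rw [h.degree_eq, h.degree_eq]
  rcases hw with hw | hw
  · have := (degree_pos_iff_exists_adj _ v).2 ⟨w, hw⟩
    omega
  · have := (degree_pos_iff_exists_adj _ (m v)).2 ⟨w, hw⟩
    omega

end Matching

lemma sqrt_le_of_sum {x y : ℝ} (hx : 1 ≤ x) (hy : 1 ≤ y) (hs : 3 ≤ x + y) :
    Real.sqrt (x ^ 2 + y ^ 2) ≤ Real.sqrt 5 + (x + y - 3) := by
  have h5 : (2 : ℝ) ≤ Real.sqrt 5 := Real.le_sqrt_of_sq_le (by norm_num)
  have h5' : Real.sqrt 5 ^ 2 = 5 := Real.sq_sqrt (by norm_num)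
  refine Real.sqrt_le_iff.2 ⟨by linarith, ?_⟩
  nlinarith [mul_nonneg (sub_nonneg.2 hx) (sub_nonneg.2 hy),
    mul_nonneg (sub_nonneg.2 h5) (sub_nonneg.2 hs)]

lemma sq_add_sq_le_of_sum {x y D : ℕ} (hD : 4 ≤ D) (hx : 2 ≤ x) (hy : 2 ≤ y) (hxD : x + 1 ≤ D)
    (hyD : y + 1 ≤ D) (hs : x + y ≤ D + 2) :
    (x : ℝ) ^ 2 + (y : ℝ) ^ 2 ≤ ((D : ℝ) - 1) ^ 2 + 9 := by
  have h1 : (x : ℝ) + 1 ≤ D := by exact_mod_cast hxD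
  have h2 : (y : ℝ) + 1 ≤ D := by exact_mod_cast hyD
  have h3 : (x : ℝ) + y ≤ D + 2 := by exact_mod_cast hs
  have h4 : (4 : ℝ) ≤ D := by exact_mod_cast hD
  rcases hx.lt_or_eq with hx | rfl
  · rcases hy.lt_or_eq with hy | rfl
    · have h5 : (3 : ℝ) ≤ x := by exact_mod_cast hx
      have h6 : (3 : ℝ) ≤ y := by exact_mod_cast hy
      nlinarith [mul_nonneg (sub_nonneg.2 h5) (sub_nonneg.2 h6),
        mul_nonneg (sub_nonneg.2 h3) (by linarith : (0 : ℝ) ≤ x + y + D + 2)]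
    · have : (2 : ℝ) ≤ x := by exact_mod_cast hx.le
      push_cast
      nlinarith
  · have : (2 : ℝ) ≤ y := by exact_mod_cast hy
    push_cast
    nlinarith

/-- The final numerical comparison when the maximum degree is less than `D = β + t`. -/
lemma bound_lt {β t D : ℝ} (hD : D = β + t) (hD5 : 5 ≤ D) (ht0 : 0 ≤ t) (ht : t ≤ D - 2) :
    (D - 1) * Real.sqrt ((D - 1) ^ 2 + 9) + (β * Real.sqrt 5 + D - 2 + t) <
      (D - 1) * Real.sqrt (D ^ 2 + 4) + Real.sqrt (D ^ 2 + 1) + Real.sqrt 5 * (β - t - 1) +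
        2 * Real.sqrt 2 * t := by
  set p := Real.sqrt ((D - 1) ^ 2 + 9) with hp
  set q := Real.sqrt (D ^ 2 + 4) with hq
  have hp0 : 0 ≤ p := Real.sqrt_nonneg _
  have hq0 : 0 ≤ q := Real.sqrt_nonneg _
  have hp2 : p ^ 2 = (D - 1) ^ 2 + 9 := Real.sq_sqrt (by positivity)
  have hq2 : q ^ 2 = D ^ 2 + 4 := Real.sq_sqrt (by positivity)
  have hpq : p ≤ q := Real.sqrt_le_sqrt (by nlinarith)
  have hqD : q * D ≤ D ^ 2 + 2 := by
    nlinarith [sq_nonneg (q - D)]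
  have hqpos : 0 < q := by nlinarith
  have h1 : D - 3 ≤ (q - p) * q := by nlinarith
  have h2 : (D - 3) * D ≤ (q - p) * (D ^ 2 + 2) := by
    have := mul_le_mul_of_nonneg_left hqD (sub_nonneg.2 hpq)
    nlinarith
  have h3 : 0.237 + 0.408 * (D - 2) < (D - 1) * (q - p) := by
    have h4 : (D - 1) * ((D - 3) * D) ≤ (D - 1) * (q - p) * (D ^ 2 + 2) := by
      have := mul_le_mul_of_nonneg_left h2 (by linarith : (0 : ℝ) ≤ D - 1)
      linarith
    have h5 : (0.237 + 0.408 * (D - 2)) * (D ^ 2 + 2) < (D - 1) * ((D - 3) * D) := by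
      obtain ⟨x, rfl⟩ : ∃ x, D = x + 5 := ⟨D - 5, by ring⟩
      have hx : 0 ≤ x := by linarith
      nlinarith [mul_nonneg hx hx, mul_nonneg hx (mul_nonneg hx hx)]
    exact lt_of_mul_lt_mul_right (h5.trans_le h4) (by positivity)
  have h6 : D ≤ Real.sqrt (D ^ 2 + 1) := Real.le_sqrt_of_sq_le (by linarith)
  have h7 : Real.sqrt 5 ≤ 2.2361 := Real.sqrt_le_iff.2 (by norm_num)
  have h8 : (1.4142 : ℝ) ≤ Real.sqrt 2 := Real.le_sqrt_of_sq_le (by norm_num)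
  have h9 := mul_le_mul_of_nonneg_right h7 ht0
  have h10 := mul_le_mul_of_nonneg_right h8 ht0
  nlinarith

section Bounds

variable {V : Type*} [Fintype V] {G : SimpleGraph V} {m : V → V}

lemma IsMatchingMap.sum_matching_le (h : IsMatchingMap G m) (A B : ℝ)
    (hf : ∀ v, Real.sqrt ((G.degree v : ℝ)^2 + (G.degree (m v) : ℝ)^2) ≤
      A + B * ((G.degree v : ℝ) + G.degree (m v))) :
    (∑ v, Real.sqrt ((G.degree v : ℝ)^2 + (G.degree (m v) : ℝ)^2)) ≤
      A * Fintype.card V + 4 * B * G.edgeFinset.card := by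
  refine (sum_le_sum fun v _ => hf v).trans_eq ?_
  have hd : ∑ v, (G.degree v : ℝ) = 2 * G.edgeFinset.card := by
    exact_mod_cast G.sum_degrees_eq_twice_card_edges
  have hd' : ∑ v, (G.degree (m v) : ℝ) = 2 * G.edgeFinset.card :=
    (h.sum_comp fun v => (G.degree v : ℝ)).trans hd
  rw [sum_add_distrib, ← mul_sum, sum_add_distrib, hd, hd', sum_const, card_univ, nsmul_eq_mul]
  ring

lemma sum_offMatching_le (p : ℝ)
    (hf : ∀ u v, (offMatching G m).Adj u v →
      Real.sqrt ((G.degree u : ℝ)^2 + (G.degree v : ℝ)^2) ≤ p) :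
    (∑ u, ∑ v, if (offMatching G m).Adj u v then
        Real.sqrt ((G.degree u : ℝ)^2 + (G.degree v : ℝ)^2) else 0) ≤
      2 * (offMatching G m).edgeFinset.card * p := by
  rw [← sum_sum_adj_const]
  refine sum_le_sum fun u _ => sum_le_sum fun v _ => ?_
  split_ifs with huv
  · exact hf u v huv
  · exact le_rfl

lemma IsMatchingMap.card_offMatching (h : IsMatchingMap G m) {β t : ℕ}
    (hcard : Fintype.card V = 2 * β) (hE : G.edgeFinset.card = 2 * β - 1 + t) (hβ : 2 ≤ β) :
    (offMatching G m).edgeFinset.card + 1 = β + t := by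
  have := h.two_mul_card_edgeFinset
  omega

lemma IsMatchingMap.degree_le (h : IsMatchingMap G m) {β t : ℕ}
    (hcard : Fintype.card V = 2 * β) (hE : G.edgeFinset.card = 2 * β - 1 + t) (hβ : 2 ≤ β)
    (v : V) : G.degree v ≤ β + t := by
  have := h.card_offMatching hcard hE hβ
  have := degree_le_card_edgeFinset (offMatching G m) v
  rw [h.degree_eq]
  omega

/-- If no vertex has degree `β + t`, the bound is strict. -/
theorem IsMatchingMap.somborIndex_lt (h : IsMatchingMap G m) (hG : G.Connected) {β t : ℕ}
    (hβ : 2 ≤ β) (hcard : Fintype.card V = 2 * β) (hE : G.edgeFinset.card = 2 * β - 1 + t)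
    (hdeg : ∀ v, G.degree v + 1 ≤ β + t) :
    somborIndex G < ((β : ℝ) + t - 1) * Real.sqrt (((β : ℝ) + t)^2 + 4) +
        Real.sqrt (((β : ℝ) + t)^2 + 1) + Real.sqrt 5 * ((β : ℝ) - t - 1) +
        2 * Real.sqrt 2 * t := by
  have hN := h.card_offMatching hcard hE hβ
  have hN' : ((offMatching G m).edgeFinset.card : ℝ) = (β : ℝ) + t - 1 := by
    rw [eq_sub_iff_add_eq]; exact_mod_cast hN
  have hE' : (G.edgeFinset.card : ℝ) = 2 * β - 1 + t := by
    have : G.edgeFinset.card + 1 = 2 * β + t := by omega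
    have : (G.edgeFinset.card : ℝ) + 1 = 2 * β + t := by exact_mod_cast this
    linarith
  have hc' : (Fintype.card V : ℝ) = 2 * β := by exact_mod_cast hcard
  have hpos : ∀ v, 1 ≤ G.degree v := fun v => by rw [h.degree_eq]; omega
  have h3 := h.three_le_degree_add hG (by omega)
  rw [h.somborIndex_eq]
  rcases lt_or_ge (β + t) 4 with hD | hD
  · have hle : ∀ u v, Real.sqrt ((G.degree u : ℝ)^2 + (G.degree v : ℝ)^2) ≤ 2 * Real.sqrt 2 := by
      intro u v
      have hu : (G.degree u : ℝ) ≤ 2 := by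
        have := hdeg u
        exact_mod_cast (by omega : G.degree u ≤ 2)
      have hv : (G.degree v : ℝ) ≤ 2 := by
        have := hdeg v
        exact_mod_cast (by omega : G.degree v ≤ 2)
      have h2 : Real.sqrt 2 ^ 2 = 2 := Real.sq_sqrt (by norm_num)
      refine Real.sqrt_le_iff.2 ⟨by positivity, ?_⟩
      nlinarith [(G.degree u).cast_nonneg (α := ℝ), (G.degree v).cast_nonneg (α := ℝ)]
    have s1 := h.sum_matching_le (2 * Real.sqrt 2) 0 fun v => by simpa using hle v (m v)
    have s2 := sum_offMatching_le (G := G) (m := m) _ fun u v _ => hle u v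
    rw [hN'] at s2
    rw [hc'] at s1
    have a2 : Real.sqrt 2 ≤ 1.4143 := Real.sqrt_le_iff.2 (by norm_num)
    have a5 : (2.236 : ℝ) ≤ Real.sqrt 5 := Real.le_sqrt_of_sq_le (by norm_num)
    have a13 : (3.605 : ℝ) ≤ Real.sqrt 13 := Real.le_sqrt_of_sq_le (by norm_num)
    have a10 : (3.162 : ℝ) ≤ Real.sqrt 10 := Real.le_sqrt_of_sq_le (by norm_num)
    obtain ⟨rfl, rfl⟩ | ⟨rfl, rfl⟩ | ⟨rfl, rfl⟩ :
        (β = 2 ∧ t = 0) ∨ (β = 2 ∧ t = 1) ∨ (β = 3 ∧ t = 0) := by omega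
    · exfalso
      obtain ⟨v⟩ := hG.nonempty
      have := h3 v
      have := hdeg v
      have := hdeg (m v)
      omega
    · norm_num at s1 s2 ⊢
      linarith
    · norm_num at s1 s2 ⊢
      linarith
  · have s2 := sum_offMatching_le (G := G) (m := m)
      (Real.sqrt ((((β + t : ℕ) : ℝ) - 1) ^ 2 + 9)) fun u v huv => by
        have e1 := h.degree_eq u
        have e2 := h.degree_eq v
        have p1 := (degree_pos_iff_exists_adj _ u).2 ⟨v, huv⟩
        have p2 := (degree_pos_iff_exists_adj _ v).2 ⟨u, huv.symm⟩
        have := degree_add_degree_le (offMatching G m) huv.ne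
        exact Real.sqrt_le_sqrt (sq_add_sq_le_of_sum hD (by omega) (by omega) (hdeg u) (hdeg v)
          (by omega))
    rw [hN'] at s2
    push_cast at s2
    have s1 := h.sum_matching_le (Real.sqrt 5 - 3) 1 fun v => by
      have := sqrt_le_of_sum (x := G.degree v) (y := G.degree (m v))
        (by exact_mod_cast hpos v) (by exact_mod_cast hpos (m v)) (by exact_mod_cast h3 v)
      linarith
    rw [hc', hE'] at s1
    rcases hD.lt_or_eq with hD | hD
    · have := bound_lt (β := β) (t := t) rfl (by exact_mod_cast hD) (by positivity)
        (by have : (2 : ℝ) ≤ β := by exact_mod_cast hβ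
            linarith)
      linarith
    · have a2 : (1.414 : ℝ) ≤ Real.sqrt 2 := Real.le_sqrt_of_sq_le (by norm_num)
      have a5 : Real.sqrt 5 ≤ 2.237 := Real.sqrt_le_iff.2 (by norm_num)
      have a5' : (2.236 : ℝ) ≤ Real.sqrt 5 := Real.le_sqrt_of_sq_le (by norm_num)
      have a17 : (4.123 : ℝ) ≤ Real.sqrt 17 := Real.le_sqrt_of_sq_le (by norm_num)
      have a20 : (4.472 : ℝ) ≤ Real.sqrt 20 := Real.le_sqrt_of_sq_le (by norm_num)
      have a18 : Real.sqrt 18 ≤ 4.243 := Real.sqrt_le_iff.2 (by norm_num)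
      obtain ⟨rfl, rfl⟩ | ⟨rfl, rfl⟩ | ⟨rfl, rfl⟩ :
        (β = 4 ∧ t = 0) ∨ (β = 3 ∧ t = 1) ∨ (β = 2 ∧ t = 2) := by omega
      · norm_num at s1 s2 ⊢
        linarith
      · norm_num at s1 s2 ⊢
        linarith
      · have s3 := h.sum_matching_le 1 0.541 fun v => by
          have := hdeg v
          have := hdeg (m v)
          have := hpos v
          have := hpos (m v)
          refine Real.sqrt_le_iff.2 ⟨by positivity, ?_⟩
          generalize G.degree v = x at *
          generalize G.degree (m v) = y at *
          have : x ≤ 3 := by omega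
          have : y ≤ 3 := by omega
          interval_cases x <;> interval_cases y <;> norm_num
        rw [hc', hE'] at s3
        norm_num at s2 s3 ⊢
        linarith

end Bounds

/-- `G` consists of the matching edges `v — m v` and of the edges joining `c` to the vertices
of `S`, and every matching edge other than `c — m c` meets `S`. -/
structure IsMatchedStar {V : Type*} (G : SimpleGraph V) (m : V → V) (c : V) (S : Finset V) :
    Prop where
  toIsMatchingMap : IsMatchingMap G m
  off_adj_iff : ∀ u v, (offMatching G m).Adj u v ↔ (u = c ∧ v ∈ S) ∨ (v = c ∧ u ∈ S)
  cover : ∀ v, v ≠ c → v ≠ m c → v ∈ S ∨ m v ∈ S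

section Star

variable {V : Type*} {G : SimpleGraph V} {m : V → V} {c : V} {S : Finset V}

lemma IsMatchedStar.center_notMem (h : IsMatchedStar G m c S) : c ∉ S := fun hc =>
  ((h.off_adj_iff c c).2 (Or.inl ⟨rfl, hc⟩)).ne rfl

lemma IsMatchedStar.partner_notMem (h : IsMatchedStar G m c S) : m c ∉ S := fun hc =>
  ((h.toIsMatchingMap.offMatching_adj _ _).1 ((h.off_adj_iff c (m c)).2 (Or.inl ⟨rfl, hc⟩))).2 rfl

variable [Fintype V]

theorem IsMatchingMap.exists_isMatchedStar (h : IsMatchingMap G m) (hG : G.Connected) {β t : ℕ}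
    (hβ : 2 ≤ β) (hcard : Fintype.card V = 2 * β) (hE : G.edgeFinset.card = 2 * β - 1 + t)
    (hc : G.degree c = β + t) : ∃ S, IsMatchedStar G m c S ∧ S.card + 1 = β + t := by
  have hN := h.card_offMatching hcard hE hβ
  have hdc := h.degree_eq c
  have hstar : ∀ u v, (offMatching G m).Adj u v → u = c ∨ v = c := fun u v =>
    eq_or_eq_of_degree_eq _ (by omega)
  refine ⟨(offMatching G m).neighborFinset c, ⟨h, fun u v => ?_, fun v hv hv' => ?_⟩, ?_⟩
  · simp only [mem_neighborFinset]
    constructor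
    · intro huv
      rcases hstar u v huv with rfl | rfl
      · exact Or.inl ⟨rfl, huv⟩
      · exact Or.inr ⟨rfl, huv.symm⟩
    · rintro (⟨rfl, a⟩ | ⟨rfl, a⟩)
      · exact a
      · exact a.symm
  · simp only [mem_neighborFinset]
    obtain ⟨w, hw | hw⟩ := h.exists_offMatching_adj hG (by omega) v
    · rcases hstar _ _ hw with e | rfl
      · exact absurd e hv
      · exact Or.inl hw.symm
    · rcases hstar _ _ hw with e | rfl
      · exact absurd ((h.eq_comm_iff c v).1 e.symm) hv'
      · exact Or.inr hw.symm
  · rw [card_neighborFinset_eq_degree]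
    omega

namespace IsMatchedStar

lemma card_single (h : IsMatchedStar G m c S) :
    Fintype.card V = 2 + S.card + (S.filter fun v => m v ∉ S).card := by
  have hm := h.toIsMatchingMap
  have inj : Function.Injective m := Function.LeftInverse.injective hm.invol
  have e : (univ : Finset V) = ({c, m c} ∪ S) ∪ (S.filter fun v => m v ∉ S).image m := by
    ext v
    simp only [mem_univ, mem_union, mem_insert, mem_singleton, mem_image, mem_filter, true_iff]
    by_cases h1 : v = c
    · simp [h1]
    by_cases h2 : v = m c
    · simp [h2]
    by_cases h3 : v ∈ S
    · simp [h3]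
    · refine Or.inr ⟨m v, ⟨(h.cover v h1 h2).resolve_left h3, ?_⟩, hm.invol v⟩
      rwa [hm.invol]
  rw [← card_univ, e, card_union_of_disjoint, card_union_of_disjoint, card_pair (hm.ne c).symm,
    card_image_of_injective _ inj]
  · rw [Finset.disjoint_left]
    intro v hv
    simp only [mem_insert, mem_singleton] at hv
    rcases hv with rfl | rfl
    · exact h.center_notMem
    · exact h.partner_notMem
  · rw [Finset.disjoint_right]
    intro v hv
    simp only [mem_image, mem_filter] at hv
    obtain ⟨w, ⟨hw, hw'⟩, rfl⟩ := hv
    simp only [mem_union, mem_insert, mem_singleton, not_or]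
    refine ⟨⟨fun e => h.partner_notMem ?_, fun e => h.center_notMem (inj e ▸ hw)⟩, hw'⟩
    rwa [← e, hm.invol]

lemma card_double (h : IsMatchedStar G m c S) {β t : ℕ} (hcard : Fintype.card V = 2 * β)
    (hS : S.card + 1 = β + t) :
    (S.filter fun v => m v ∈ S).card = 2 * t ∧
      (S.filter fun v => m v ∉ S).card + t + 1 = β := by
  have h1 := h.card_single
  have h2 := card_filter_add_card_filter_not (s := S) (fun v => m v ∈ S)
  omega

lemma degree_center (h : IsMatchedStar G m c S) : G.degree c = S.card + 1 := by
  rw [h.toIsMatchingMap.degree_eq, ← card_neighborFinset_eq_degree]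
  congr 2
  ext w
  have := h.center_notMem
  simp only [mem_neighborFinset, h.off_adj_iff]
  tauto

lemma degree_of_mem (h : IsMatchedStar G m c S) {v : V} (hv : v ∈ S) : G.degree v = 2 := by
  have hvc : v ≠ c := fun e => h.center_notMem (e ▸ hv)
  rw [h.toIsMatchingMap.degree_eq, ← card_neighborFinset_eq_degree]
  have : (offMatching G m).neighborFinset v = {c} := by
    ext w
    simp only [mem_neighborFinset, h.off_adj_iff, mem_singleton]
    tauto
  rw [this, card_singleton]

lemma degree_of_notMem (h : IsMatchedStar G m c S) {v : V} (hv : v ∉ S) (hvc : v ≠ c) :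
    G.degree v = 1 := by
  rw [h.toIsMatchingMap.degree_eq, ← card_neighborFinset_eq_degree]
  have : (offMatching G m).neighborFinset v = ∅ := by
    ext w
    simp only [mem_neighborFinset, h.off_adj_iff, notMem_empty]
    tauto
  rw [this, card_empty]

theorem somborIndex_eq (h : IsMatchedStar G m c S) {β t : ℕ} (hcard : Fintype.card V = 2 * β)
    (hE : G.edgeFinset.card = 2 * β - 1 + t) (hβ : 2 ≤ β) (hS : S.card + 1 = β + t) :
    somborIndex G = ((β : ℝ) + t - 1) * Real.sqrt (((β : ℝ) + t)^2 + 4) +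
        Real.sqrt (((β : ℝ) + t)^2 + 1) + Real.sqrt 5 * ((β : ℝ) - t - 1) +
        2 * Real.sqrt 2 * t := by
  have hm := h.toIsMatchingMap
  have hN := hm.card_offMatching hcard hE hβ
  have hN' : ((offMatching G m).edgeFinset.card : ℝ) = (β : ℝ) + t - 1 := by
    rw [eq_sub_iff_add_eq]; exact_mod_cast hN
  have hdc : (G.degree c : ℝ) = β + t := by
    rw [h.degree_center, hS]; push_cast; rfl
  have h8 : Real.sqrt 8 = 2 * Real.sqrt 2 := by
    rw [show (8 : ℝ) = 2 ^ 2 * 2 by norm_num, Real.sqrt_mul (by norm_num),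
      Real.sqrt_sq (by norm_num)]
  have hoff : (∑ u, ∑ v, if (offMatching G m).Adj u v then
        Real.sqrt ((G.degree u : ℝ)^2 + (G.degree v : ℝ)^2) else 0) =
      2 * ((β : ℝ) + t - 1) * Real.sqrt (((β : ℝ) + t)^2 + 4) := by
    rw [← hN', ← sum_sum_adj_const]
    refine sum_congr rfl fun u _ => sum_congr rfl fun v _ => ?_
    split_ifs with huv
    · rcases (h.off_adj_iff u v).1 huv with ⟨rfl, hv⟩ | ⟨rfl, hu⟩
      · rw [hdc, h.degree_of_mem hv]
        norm_num
      · rw [hdc, h.degree_of_mem hu, add_comm]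
        norm_num
    · rfl
  have hmat : (∑ v, Real.sqrt ((G.degree v : ℝ)^2 + (G.degree (m v) : ℝ)^2)) =
      ∑ v, (Real.sqrt 5 + (if v = c then Real.sqrt (((β : ℝ) + t)^2 + 1) - Real.sqrt 5 else 0) +
        (if v = m c then Real.sqrt (((β : ℝ) + t)^2 + 1) - Real.sqrt 5 else 0) +
        (if v ∈ S.filter (fun v => m v ∈ S) then 2 * Real.sqrt 2 - Real.sqrt 5 else 0)) := by
    refine sum_congr rfl fun v _ => ?_
    have hmc : (G.degree (m c) : ℝ) = 1 := by
      exact_mod_cast h.degree_of_notMem h.partner_notMem (hm.ne c)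
    by_cases h1 : v = c
    · subst h1
      simp [(hm.ne v).symm, h.center_notMem, hdc, hmc]
    by_cases h2 : v = m c
    · subst h2
      rw [hm.invol, hmc, hdc]
      simp [hm.ne c, h.partner_notMem, add_comm]
    have h3 : m v ≠ c := fun e => h2 ((hm.eq_comm_iff c v).1 e.symm)
    by_cases h4 : v ∈ S <;> by_cases h5 : m v ∈ S
    · simp only [h1, h2, mem_filter, h4, h5, h.degree_of_mem h4, h.degree_of_mem h5]
      norm_num [h8]
    · simp only [h1, h2, mem_filter, h4, h5, h.degree_of_mem h4, h.degree_of_notMem h5 h3]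
      norm_num
    · simp only [h1, h2, mem_filter, h4, h5, h.degree_of_notMem h4 h1, h.degree_of_mem h5]
      norm_num
    · exact absurd (h.cover v h1 h2) (by tauto)
  rw [hm.somborIndex_eq, hoff, hmat]
  simp only [sum_add_distrib, sum_ite_eq', mem_univ, if_true, sum_const, card_univ, hcard,
    nsmul_eq_mul, sum_ite_mem, univ_inter, (h.card_double hcard hS).1]
  push_cast
  ring

end IsMatchedStar

end Star

/-- Vertices of the extremal graph: `(none, false)` is the center, `(some (inl k), b)` are the
outer vertices of the `k`-th triangle, `(some (inr j), false)` are the other neighbors of degree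
two, and flipping the boolean passes to the matched vertex. -/
abbrev StarVertex (t p : ℕ) : Type := Option (Fin t ⊕ Fin p) × Bool

/-- The vertices of degree two adjacent to the center. -/
def StarVertex.IsMiddle {t p : ℕ} : StarVertex t p → Prop
  | (none, _) => False
  | (some (Sum.inl _), _) => True
  | (some (Sum.inr _), b) => b = false

/-- Adjacency in the extremal graph. -/
def StarVertex.Adj {t p : ℕ} (x y : StarVertex t p) : Prop :=
  y = (x.1, !x.2) ∨ (x = (none, false) ∧ y.IsMiddle) ∨ (y = (none, false) ∧ x.IsMiddle)

lemma card_starVertex (t p : ℕ) : Fintype.card (StarVertex t p) = 2 * (t + p + 1) := by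
  simp [StarVertex, Fintype.card_prod]
  ring

section Equivalence

variable {V : Type*} [Fintype V] {G : SimpleGraph V} {m : V → V} {c : V} {S : Finset V}

/-- A fixed-point-free involution on a finite set of size `2 * t` has a set of `t`
representatives. -/
lemma exists_representatives (hm : ∀ v, m (m v) = v) (hne : ∀ v, m v ≠ v) {T : Finset V}
    (hT : ∀ v ∈ T, m v ∈ T) {t : ℕ} (hcard : T.card = 2 * t) :
    ∃ R ⊆ T, R.card = t ∧ ∀ v ∈ T, v ∈ R ∨ m v ∈ R := by
  let φ := Fintype.equivFin V
  have inj : Function.Injective m := Function.LeftInverse.injective hm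
  have e : T.filter (fun v => ¬ φ v < φ (m v)) = (T.filter fun v => φ v < φ (m v)).image m := by
    ext v
    simp only [mem_image, mem_filter]
    constructor
    · rintro ⟨h1, h2⟩
      refine ⟨m v, ⟨hT v h1, ?_⟩, hm v⟩
      rw [hm]
      exact lt_of_le_of_ne (not_lt.1 h2) fun e => hne v (φ.injective e)
    · rintro ⟨w, ⟨h1, h2⟩, rfl⟩
      rw [hm]
      exact ⟨hT w h1, not_lt.2 h2.le⟩
  refine ⟨T.filter fun v => φ v < φ (m v), filter_subset _ _, ?_, fun v hv => ?_⟩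
  · have h1 := card_filter_add_card_filter_not (s := T) (fun v => φ v < φ (m v))
    rw [e, card_image_of_injective _ inj] at h1
    omega
  · by_cases h : φ v < φ (m v)
    · exact Or.inl (mem_filter.2 ⟨hv, h⟩)
    · refine Or.inr (mem_filter.2 ⟨hT v hv, ?_⟩)
      rw [hm]
      exact lt_of_le_of_ne (not_lt.1 h) fun e => hne v (φ.injective e)

theorem IsMatchedStar.exists_equiv (h : IsMatchedStar G m c S) {β t p : ℕ}
    (hcard : Fintype.card V = 2 * β) (hS : S.card + 1 = β + t) (hp : t + p + 1 = β) :
    ∃ e : StarVertex t p ≃ V, ∀ x y, G.Adj (e x) (e y) ↔ x.Adj y := by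
  have hm := h.toIsMatchingMap
  obtain ⟨hT, hP⟩ := h.card_double hcard hS
  obtain ⟨R, hRT, hR, hRcov⟩ := exists_representatives hm.invol hm.ne
    (T := S.filter fun v => m v ∈ S)
    (fun v hv => by
      simp only [mem_filter] at hv ⊢
      exact ⟨hv.2, by rw [hm.invol]; exact hv.1⟩) hT
  have hP' : (S.filter fun v => m v ∉ S).card = p := by omega
  let a := R.equivFinOfCardEq hR
  let b := (S.filter fun v => m v ∉ S).equivFinOfCardEq hP'
  let r : Option (Fin t ⊕ Fin p) → V
    | none => c
    | some (Sum.inl k) => a.symm k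
    | some (Sum.inr j) => b.symm j
  let f : StarVertex t p → V := fun x => if x.2 then m (r x.1) else r x.1
  have hsurj : Function.Surjective f := by
    have key : ∀ v, (∃ o, r o = v) ∨ ∃ o, r o = m v := by
      intro v
      by_cases h1 : v = c
      · exact Or.inl ⟨none, h1.symm⟩
      by_cases h2 : v = m c
      · exact Or.inr ⟨none, by rw [h2, hm.invol]⟩
      have single : ∀ w, w ∈ S → m w ∉ S → ∃ o, r o = w := fun w hw hw' =>
        ⟨some (Sum.inr (b ⟨w, mem_filter.2 ⟨hw, hw'⟩⟩)), by simp [r]⟩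
      have rep : ∀ w, w ∈ R → ∃ o, r o = w := fun w hw =>
        ⟨some (Sum.inl (a ⟨w, hw⟩)), by simp [r]⟩
      by_cases h3 : v ∈ S <;> by_cases h4 : m v ∈ S
      · exact (hRcov v (mem_filter.2 ⟨h3, h4⟩)).imp (rep v) (rep (m v))
      · exact Or.inl (single v h3 h4)
      · exact Or.inr (single (m v) h4 (by rwa [hm.invol]))
      · exact absurd (h.cover v h1 h2) (by tauto)
    intro v
    rcases key v with ⟨o, ho⟩ | ⟨o, ho⟩
    · exact ⟨(o, false), by simp [f, ho]⟩
    · exact ⟨(o, true), by simp [f, ho, hm.invol]⟩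
  have hbij : Function.Bijective f :=
    (Fintype.bijective_iff_surjective_and_card f).2
      ⟨hsurj, by rw [card_starVertex, hcard]; omega⟩
  have hfm : ∀ x, m (f x) = f (x.1, !x.2) := by
    rintro ⟨o, _ | _⟩
    · simp [f]
    · simp [f, hm.invol]
  have hfc : ∀ x, f x = c ↔ x = (none, false) := fun x => by
    rw [show c = f (none, false) by simp [f, r]]
    exact hbij.1.eq_iff
  have hfS : ∀ x, f x ∈ S ↔ x.IsMiddle := by
    have ha : ∀ k, (a.symm k : V) ∈ S ∧ m (a.symm k) ∈ S := fun k => by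
      have := hRT (a.symm k).2
      simpa using this
    have hb : ∀ j, (b.symm j : V) ∈ S ∧ m (b.symm j) ∉ S := fun j => by
      have := (b.symm j).2
      rwa [mem_filter] at this
    rintro ⟨_ | k | j, _ | _⟩
    · simpa [f, r, StarVertex.IsMiddle] using h.center_notMem
    · simpa [f, r, StarVertex.IsMiddle] using h.partner_notMem
    · simpa [f, r, StarVertex.IsMiddle] using (ha k).1
    · simpa [f, r, StarVertex.IsMiddle] using (ha k).2
    · simpa [f, r, StarVertex.IsMiddle] using (hb j).1
    · simpa [f, r, StarVertex.IsMiddle] using (hb j).2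
  refine ⟨Equiv.ofBijective f hbij, fun x y => ?_⟩
  simp only [Equiv.ofBijective_apply]
  rw [hm.adj_iff, h.off_adj_iff, hfm, hbij.1.eq_iff, hfc, hfc, hfS, hfS, StarVertex.Adj]
  tauto

end Equivalence

lemma hstarGraph_adj (β t : ℕ) (u v : Fin (2 * β)) : (HstarGraph β t).Adj u v ↔ u ≠ v ∧
    (((u.val = 0 ∧ 1 ≤ v.val ∧ v.val ≤ β + t) ∨
      (u.val % 2 = 1 ∧ u.val < 2 * t ∧ v.val = u.val + 1) ∨
      (2 * t < u.val ∧ u.val < β + t ∧ v.val + t = u.val + β)) ∨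
    ((v.val = 0 ∧ 1 ≤ u.val ∧ u.val ≤ β + t) ∨
      (v.val % 2 = 1 ∧ v.val < 2 * t ∧ u.val = v.val + 1) ∨
      (2 * t < v.val ∧ v.val < β + t ∧ u.val + t = v.val + β))) := by
  have tri : ∀ x y : ℕ, (∃ k, k < t ∧ x = 2 * k + 1 ∧ y = 2 * k + 2) ↔
      (x % 2 = 1 ∧ x < 2 * t ∧ y = x + 1) := fun x y =>
    ⟨fun ⟨k, hk⟩ => by omega, fun h => ⟨x / 2, by omega⟩⟩
  have pend : ∀ x y : ℕ, (∃ j, 1 ≤ j ∧ j ≤ β - t - 1 ∧ x = 2 * t + j ∧ y = β + t + j) ↔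
      (2 * t < x ∧ x < β + t ∧ y + t = x + β) := fun x y =>
    ⟨fun ⟨j, hj⟩ => by omega, fun h => ⟨x - 2 * t, by omega⟩⟩
  rw [HstarGraph, SimpleGraph.fromRel_adj, tri, tri, pend, pend]

theorem exists_equiv_hstarGraph {β t p : ℕ} (hp : t + p + 1 = β) :
    ∃ e : StarVertex t p ≃ Fin (2 * β), ∀ x y, (HstarGraph β t).Adj (e x) (e y) ↔ x.Adj y := by
  let g : StarVertex t p → ℕ
    | (none, false) => 0
    | (none, true) => β + t
    | (some (Sum.inl k), false) => 2 * k + 1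
    | (some (Sum.inl k), true) => 2 * k + 2
    | (some (Sum.inr j), false) => 2 * t + 1 + j
    | (some (Sum.inr j), true) => β + t + 1 + j
  have hg : ∀ x, g x < 2 * β := by
    rintro ⟨_ | k | j, _ | _⟩ <;> simp only [g] <;> omega
  have hbij : Function.Bijective fun x => (⟨g x, hg x⟩ : Fin (2 * β)) := by
    refine (Fintype.bijective_iff_injective_and_card _).2
      ⟨?_, by rw [card_starVertex, Fintype.card_fin]; omega⟩
    rintro ⟨_ | k | j, _ | _⟩ ⟨_ | k' | j', _ | _⟩ hxy <;>
      simp only [g, Fin.mk.injEq] at hxy <;>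
      first
        | rfl
        | (exfalso; omega)
        | (have : k = k' := Fin.ext (by omega)
           rw [this])
        | (have : j = j' := Fin.ext (by omega)
           rw [this])
  refine ⟨Equiv.ofBijective _ hbij, fun x y => ?_⟩
  rw [hstarGraph_adj]
  simp only [Equiv.ofBijective_apply, ne_eq, Fin.mk.injEq]
  rcases x with ⟨_ | k | j, _ | _⟩ <;> rcases y with ⟨_ | k' | j', _ | _⟩ <;>
    simp only [g, StarVertex.Adj, StarVertex.IsMiddle, Prod.mk.injEq, Option.some.injEq,
      Sum.inl.injEq, Sum.inr.injEq, reduceCtorEq, Bool.not_true, Bool.not_false, and_true,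
      and_false, true_and, false_and, or_false, false_or, iff_true, iff_false, Fin.ext_iff, not_false_eq_true] <;>
    omega

lemma degree_hstarGraph_zero {β t : ℕ} (ht : t < β) :
    β + t ≤ (HstarGraph β t).degree ⟨0, by omega⟩ := by
  rw [← card_neighborFinset_eq_degree]
  have : ∀ k : Fin (β + t), k.val + 1 < 2 * β := fun k => by omega
  let f : Fin (β + t) → Fin (2 * β) := fun k => ⟨k.val + 1, this k⟩
  have hf : Function.Injective f := fun x y hxy => by
    simp only [f, Fin.mk.injEq] at hxy
    exact Fin.ext (by omega)
  calc β + t = (univ.image f).card := by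
        rw [card_image_of_injective _ hf, card_univ, Fintype.card_fin]
    _ ≤ _ := by
        refine card_le_card fun v hv => ?_
        simp only [mem_image, mem_univ, true_and] at hv
        obtain ⟨k, rfl⟩ := hv
        rw [mem_neighborFinset, hstarGraph_adj]
        have := k.isLt
        exact ⟨fun e => absurd (congrArg Fin.val e) (by simp [f]),
          Or.inl (Or.inl ⟨rfl, by simp [f], by simp only [f]; omega⟩)⟩

lemma degree_hstarGraph_le_two {β t : ℕ} (ht : β ≤ t) (v : Fin (2 * β)) (hv : v.val ≠ 0) :
    (HstarGraph β t).degree v ≤ 2 := by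
  rw [← card_neighborFinset_eq_degree, ← card_image_of_injective _ Fin.val_injective]
  refine (card_le_card (t := {0, if v.val % 2 = 1 then v.val + 1 else v.val - 1})
    fun w hw => ?_).trans card_le_two
  simp only [mem_image, mem_neighborFinset, hstarGraph_adj] at hw
  obtain ⟨w, ⟨-, hw⟩, rfl⟩ := hw
  rw [mem_insert, mem_singleton]
  split_ifs <;> omega

lemma card_edgeFinset_hstarGraph_lt {β t : ℕ} (hβ : 2 ≤ β) (ht : β ≤ t) :
    (HstarGraph β t).edgeFinset.card < 2 * β - 1 + t := by
  have h1 := (HstarGraph β t).sum_degrees_eq_twice_card_edges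
  have h2 := sum_le_sum fun v (_ : v ∈ univ.erase (⟨0, by omega⟩ : Fin (2 * β))) =>
    degree_hstarGraph_le_two ht v fun e => by
      simp only [mem_erase] at *
      exact absurd (Fin.ext e) (by tauto)
  have h3 := add_sum_erase univ (fun v => (HstarGraph β t).degree v)
    (mem_univ (⟨0, by omega⟩ : Fin (2 * β)))
  have h4 := (HstarGraph β t).degree_lt_card_verts ⟨0, by omega⟩
  rw [sum_const, card_erase_of_mem (mem_univ _), card_univ, Fintype.card_fin, smul_eq_mul] at h2
  rw [Fintype.card_fin] at h4
  omega

end SomborCactus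

theorem cactus_pm_sombor_le {V : Type*} [Fintype V] (G : SimpleGraph V) (β t : ℕ)
    (hβ : 2 ≤ β) (hcard : Fintype.card V = 2 * β) (hcactus : IsCactus G)
    (hcycles : G.edgeFinset.card = 2 * β - 1 + t)
    (hpm : ∃ M : G.Subgraph, M.IsPerfectMatching) :
    somborIndex G ≤ ((β : ℝ) + t - 1) * Real.sqrt (((β : ℝ) + t)^2 + 4) +
        Real.sqrt (((β : ℝ) + t)^2 + 1) + Real.sqrt 5 * ((β : ℝ) - t - 1) +
        2 * Real.sqrt 2 * t ∧
    (somborIndex G = ((β : ℝ) + t - 1) * Real.sqrt (((β : ℝ) + t)^2 + 4) +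
        Real.sqrt (((β : ℝ) + t)^2 + 1) + Real.sqrt 5 * ((β : ℝ) - t - 1) +
        2 * Real.sqrt 2 * t ↔
      Nonempty (G ≃g HstarGraph β t)) := by
  obtain ⟨M, hM⟩ := hpm
  obtain ⟨m, hm⟩ := SomborCactus.exists_isMatchingMap hM
  by_cases hc : ∃ c, G.degree c = β + t
  · obtain ⟨c, hc⟩ := hc
    obtain ⟨S, hS, hScard⟩ := hm.exists_isMatchedStar hcactus.1 hβ hcard hcycles hc
    have hval := hS.somborIndex_eq hcard hcycles hβ hScard
    obtain ⟨-, hp⟩ := hS.card_double hcard hScard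
    have hp' : t + (β - t - 1) + 1 = β := by omega
    obtain ⟨e, he⟩ := hS.exists_equiv hcard hScard hp'
    obtain ⟨e', he'⟩ := SomborCactus.exists_equiv_hstarGraph hp'
    refine ⟨hval.le, iff_of_true hval ⟨⟨e.symm.trans e', fun {x y} => ?_⟩⟩⟩
    rw [Equiv.trans_apply, Equiv.trans_apply, he', ← he, Equiv.apply_symm_apply,
      Equiv.apply_symm_apply]
  · have hlt := hm.somborIndex_lt hcactus.1 hβ hcard hcycles fun v =>
      lt_of_le_of_ne (hm.degree_le hcard hcycles hβ v) fun e => hc ⟨v, e⟩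
    refine ⟨hlt.le, iff_of_false hlt.ne ?_⟩
    rintro ⟨e⟩
    rcases lt_or_ge t β with ht | ht
    · refine hc ⟨e.symm ⟨0, by omega⟩, le_antisymm (hm.degree_le hcard hcycles hβ _) ?_⟩
      rw [e.symm.degree_eq]
      exact SomborCactus.degree_hstarGraph_zero ht
    · have := SomborCactus.card_edgeFinset_hstarGraph_lt hβ ht
      have := e.card_edgeFinset_eq
      omega
end
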